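/- arXiv:1906.06497 — 2 statements merged into one kernel-verified Lean document; each statement's English description precedes it below -/
import Mathlib

section
/- Let 0 < α < 1 and γ ∈ (0,1). There exists a constant c > 0, depending only on α and γ, with the following property. Let V be a normed vector space, τ > 0, n ≥ 1, and φ^0, φ^1, …, φ^n ∈ V with φ^0 = 0. Then τ Σ_{j=1}^n (t_{n+1} - t_j)^{α/2 - 1} ‖∂̄_τ^γ φ^j‖ ≤ c · τ^{1-γ} Σ_{j=1}^n (t_{n+1} - t_j)^{α/2 - 1} ‖φ^j‖, where t_k = kτ and ∂̄_τ^γ φ^j = τ^{-γ} Σ_{ℓ=0}^j b_ℓ^{(γ)} φ^{j-ℓ}. -/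
/-- The backward Euler convolution quadrature weights `b_ℓ^(γ) = (-1)^ℓ binom(γ, ℓ)`. -/
noncomputable def cqWeight (γ : ℝ) (ℓ : ℕ) : ℝ :=
  (-1 : ℝ) ^ ℓ * (∏ i ∈ Finset.range ℓ, (γ - i)) / (Nat.factorial ℓ)

/-- The backward Euler CQ approximation `∂̄_τ^γ φ^j = τ^{-γ} Σ_{ℓ=0}^j b_ℓ^(γ) φ^{j-ℓ}`. -/
noncomputable def cqDeriv (γ : ℝ) {V : Type*} [AddCommGroup V] [Module ℝ V]
    (τ : ℝ) (φ : ℕ → V) (j : ℕ) : V :=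
  τ ^ (-γ) • ∑ ℓ ∈ Finset.range (j + 1), cqWeight γ ℓ • φ (j - ℓ)

theorem cqWeight_zero (γ : ℝ) : cqWeight γ 0 = 1 := by simp [cqWeight]

theorem cqWeight_succ (γ : ℝ) (ℓ : ℕ) :
    cqWeight γ (ℓ + 1) = cqWeight γ ℓ * ((ℓ - γ) / (ℓ + 1)) := by
  have : (ℓ : ℝ) + 1 ≠ 0 := by positivity
  simp only [cqWeight, Finset.prod_range_succ, Nat.factorial_succ, pow_succ, Nat.cast_mul,
    Nat.cast_add, Nat.cast_one]
  field_simp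
  ring

theorem abs_cqWeight_one {γ : ℝ} (hγ : 0 < γ) : |cqWeight γ 1| = γ := by
  have h := cqWeight_succ γ 0
  rw [zero_add, cqWeight_zero] at h
  simp [h, abs_of_pos hγ]

/-- For `0 < γ < 1` the absolute weights satisfy a positive recursion past the first index. -/
theorem abs_cqWeight_succ {γ : ℝ} (hγ1 : γ < 1) {ℓ : ℕ} (hℓ : 1 ≤ ℓ) :
    |cqWeight γ (ℓ + 1)| = |cqWeight γ ℓ| * ((ℓ - γ) / (ℓ + 1)) := by
  have hℓ' : (1 : ℝ) ≤ ℓ := by exact_mod_cast hℓ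
  rw [cqWeight_succ, abs_mul, abs_of_nonneg (a := ((ℓ : ℝ) - γ) / (ℓ + 1))]
  exact div_nonneg (by linarith) (by linarith)

theorem mul_abs_cqWeight_le {γ : ℝ} (hγ0 : 0 < γ) (hγ1 : γ < 1) (ℓ : ℕ) :
    ℓ * |cqWeight γ ℓ| ≤ 1 := by
  rcases Nat.eq_zero_or_pos ℓ with rfl | hℓ
  · simp
  induction ℓ, hℓ using Nat.le_induction with
  | base => simpa [abs_cqWeight_one hγ0] using hγ1.le
  | succ ℓ hℓ ih =>
    have h0 := abs_nonneg (cqWeight γ ℓ)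
    have h1 : ((ℓ + 1 : ℕ) : ℝ) * |cqWeight γ (ℓ + 1)| = (ℓ - γ) * |cqWeight γ ℓ| := by
      rw [abs_cqWeight_succ hγ1 hℓ]
      push_cast
      field_simp
    rw [h1]
    nlinarith

theorem sum_abs_cqWeight {γ : ℝ} (hγ0 : 0 < γ) (hγ1 : γ < 1) {L : ℕ} (hL : 1 ≤ L) :
    ∑ ℓ ∈ Finset.range L, |cqWeight γ ℓ| = 2 - L / γ * |cqWeight γ L| := by
  induction L, hL using Nat.le_induction with
  | base =>
    simp only [Finset.sum_range_one, cqWeight_zero, abs_one, abs_cqWeight_one hγ0, Nat.cast_one]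
    field_simp
    norm_num
  | succ L hL ih =>
    rw [Finset.sum_range_succ, ih, abs_cqWeight_succ hγ1 hL]
    push_cast
    field_simp
    ring

theorem sum_abs_cqWeight_le_two {γ : ℝ} (hγ0 : 0 < γ) (hγ1 : γ < 1) (L : ℕ) :
    ∑ ℓ ∈ Finset.range L, |cqWeight γ ℓ| ≤ 2 := by
  rcases Nat.eq_zero_or_pos L with rfl | hL
  · simp
  · rw [sum_abs_cqWeight hγ0 hγ1 hL]
    have : 0 ≤ L / γ * |cqWeight γ L| := by positivity
    linarith

theorem mul_rpow_sub_one_le {p : ℝ} (hp0 : 0 ≤ p) (hp1 : p ≤ 1) (i : ℕ) :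
    p * ((i : ℝ) + 1) ^ (p - 1) ≤ ((i : ℝ) + 1) ^ p - (i : ℝ) ^ p := by
  have hi : (0 : ℝ) < (i : ℝ) + 1 := by positivity
  have hinv : ((i : ℝ) + 1)⁻¹ ≤ 1 := inv_le_one_of_one_le₀ (by linarith [i.cast_nonneg (α := ℝ)])
  have hB := rpow_one_add_le_one_add_mul_self (s := -((i : ℝ) + 1)⁻¹) (by linarith) hp0 hp1
  have hmul : (i : ℝ) ^ p = (1 + -((i : ℝ) + 1)⁻¹) ^ p * ((i : ℝ) + 1) ^ p := by
    rw [← Real.mul_rpow (by linarith) hi.le]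
    congr 1
    field_simp
    ring
  have hs : ((i : ℝ) + 1) ^ (p - 1) = ((i : ℝ) + 1) ^ p * ((i : ℝ) + 1)⁻¹ := by
    rw [Real.rpow_sub_one hi.ne', div_eq_mul_inv]
  have hpos : 0 ≤ ((i : ℝ) + 1) ^ p := by positivity
  rw [hmul, hs]
  nlinarith [mul_le_mul_of_nonneg_right hB hpos]

theorem sum_rpow_sub_one_le {p : ℝ} (hp0 : 0 < p) (hp1 : p ≤ 1) (m : ℕ) :
    ∑ i ∈ Finset.range m, ((i : ℝ) + 1) ^ (p - 1) ≤ (m : ℝ) ^ p / p := by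
  rw [le_div_iff₀ hp0, mul_comm, Finset.mul_sum]
  have h := Finset.sum_le_sum fun i (_ : i ∈ Finset.range m) =>
    mul_rpow_sub_one_le hp0.le hp1 i
  have htel := Finset.sum_range_sub (fun i : ℕ => (i : ℝ) ^ p) m
  push_cast at htel
  rw [htel, Real.zero_rpow hp0.ne', sub_zero] at h
  exact h

theorem abs_cqWeight_mul_rpow_le {γ p : ℝ} (hγ0 : 0 < γ) (hγ1 : γ < 1) (hp0 : 0 < p)
    (hp1 : p ≤ 1) {m ℓ : ℕ} (hℓ : ℓ < m) :
    |cqWeight γ ℓ| * ((m : ℝ) - ℓ) ^ (p - 1) ≤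
      2 * (m : ℝ) ^ (p - 1) * |cqWeight γ ℓ| + 2 / m * ((m : ℝ) - ℓ) ^ (p - 1) := by
  have hℓ' : (ℓ : ℝ) < m := by exact_mod_cast hℓ
  have hm : (0 : ℝ) < m := lt_of_le_of_lt ℓ.cast_nonneg hℓ'
  have hb := abs_nonneg (cqWeight γ ℓ)
  have hw : 0 ≤ ((m : ℝ) - ℓ) ^ (p - 1) := Real.rpow_nonneg (by linarith) _
  rcases le_total (2 * (ℓ : ℝ)) m with h | h
  · have h1 : ((m : ℝ) - ℓ) ^ (p - 1) ≤ ((m : ℝ) / 2) ^ (p - 1) :=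
      Real.rpow_le_rpow_of_nonpos (by positivity) (by linarith) (by linarith)
    have h2 : ((m : ℝ) / 2) ^ (p - 1) ≤ 2 * (m : ℝ) ^ (p - 1) := by
      rw [Real.div_rpow hm.le two_pos.le, div_eq_mul_inv, ← Real.rpow_neg two_pos.le, mul_comm]
      gcongr
      calc (2 : ℝ) ^ (-(p - 1)) ≤ 2 ^ (1 : ℝ) :=
            Real.rpow_le_rpow_of_exponent_le one_le_two (by linarith)
        _ = 2 := Real.rpow_one 2
    have h3 : 0 ≤ 2 / (m : ℝ) * ((m : ℝ) - ℓ) ^ (p - 1) := by positivity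
    nlinarith [mul_le_mul_of_nonneg_left (h1.trans h2) hb]
  · have h1 : |cqWeight γ ℓ| ≤ 2 / m := by
      rw [le_div_iff₀ hm]
      nlinarith [mul_abs_cqWeight_le hγ0 hγ1 ℓ]
    have h2 : 0 ≤ 2 * (m : ℝ) ^ (p - 1) * |cqWeight γ ℓ| := by positivity
    nlinarith [mul_le_mul_of_nonneg_right h1 hw]

/-- Discrete convolution of the absolute weights with a weakly singular kernel is bounded by
that kernel. -/
theorem sum_abs_cqWeight_mul_rpow_le {γ p : ℝ} (hγ0 : 0 < γ) (hγ1 : γ < 1) (hp0 : 0 < p)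
    (hp1 : p ≤ 1) (m : ℕ) :
    ∑ ℓ ∈ Finset.range m, |cqWeight γ ℓ| * ((m : ℝ) - ℓ) ^ (p - 1) ≤
      (4 + 2 / p) * (m : ℝ) ^ (p - 1) := by
  rcases Nat.eq_zero_or_pos m with rfl | hm
  · simp only [Finset.range_zero, Finset.sum_empty]
    positivity
  have hm' : (0 : ℝ) < m := by exact_mod_cast hm
  have hrefl : ∑ ℓ ∈ Finset.range m, ((m : ℝ) - ℓ) ^ (p - 1) =
      ∑ i ∈ Finset.range m, ((i : ℝ) + 1) ^ (p - 1) := by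
    rw [← Finset.sum_range_reflect]
    refine Finset.sum_congr rfl fun i hi => ?_
    have : i + 1 ≤ m := Finset.mem_range.mp hi
    rw [Nat.sub_sub, Nat.cast_sub (by omega)]
    push_cast
    congr 1
    ring
  calc ∑ ℓ ∈ Finset.range m, |cqWeight γ ℓ| * ((m : ℝ) - ℓ) ^ (p - 1)
      ≤ ∑ ℓ ∈ Finset.range m, (2 * (m : ℝ) ^ (p - 1) * |cqWeight γ ℓ| +
          2 / m * ((m : ℝ) - ℓ) ^ (p - 1)) :=
        Finset.sum_le_sum fun ℓ hℓ =>
          abs_cqWeight_mul_rpow_le hγ0 hγ1 hp0 hp1 (Finset.mem_range.mp hℓ)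
    _ = 2 * (m : ℝ) ^ (p - 1) * ∑ ℓ ∈ Finset.range m, |cqWeight γ ℓ| +
          2 / m * ∑ i ∈ Finset.range m, ((i : ℝ) + 1) ^ (p - 1) := by
        rw [Finset.sum_add_distrib, ← Finset.mul_sum, ← Finset.mul_sum, hrefl]
    _ ≤ 2 * (m : ℝ) ^ (p - 1) * 2 + 2 / m * ((m : ℝ) ^ p / p) := by
        gcongr
        · exact sum_abs_cqWeight_le_two hγ0 hγ1 m
        · exact sum_rpow_sub_one_le hp0 hp1 m
    _ = (4 + 2 / p) * (m : ℝ) ^ (p - 1) := by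
        rw [Real.rpow_sub_one hm'.ne']
        field_simp
        ring

theorem norm_cqDeriv_le {V : Type*} [NormedAddCommGroup V] [NormedSpace ℝ V] (γ : ℝ) {τ : ℝ}
    (hτ : 0 < τ) {φ : ℕ → V} (hφ : φ 0 = 0) (j : ℕ) :
    ‖cqDeriv γ τ φ j‖ ≤
      τ ^ (-γ) * ∑ k ∈ Finset.Icc 1 j, |cqWeight γ (j - k)| * ‖φ k‖ := by
  have hsum : ∑ k ∈ Finset.Icc 1 j, |cqWeight γ (j - k)| * ‖φ k‖ =
      ∑ ℓ ∈ Finset.range (j + 1), |cqWeight γ ℓ| * ‖φ (j - ℓ)‖ := by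
    rw [← Finset.sum_flip]
    trans ∑ k ∈ Finset.range (j + 1), |cqWeight γ (j - k)| * ‖φ k‖
    · refine Finset.sum_subset (fun k hk => ?_) fun k hk hk' => ?_
      · simp only [Finset.mem_Icc, Finset.mem_range] at *
        omega
      · have : k = 0 := by
          simp only [Finset.mem_Icc, Finset.mem_range] at *
          omega
        simp [this, hφ]
    · refine Finset.sum_congr rfl fun k hk => ?_
      rw [Nat.sub_sub_self (Nat.lt_succ_iff.mp (Finset.mem_range.mp hk))]
  rw [hsum, cqDeriv, norm_smul, Real.norm_of_nonneg (by positivity)]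
  gcongr
  refine (norm_sum_le _ _).trans_eq (Finset.sum_congr rfl fun ℓ _ => ?_)
  rw [norm_smul, Real.norm_eq_abs]

theorem sum_weight_mul_abs_cqWeight_le {γ p τ : ℝ} (hγ0 : 0 < γ) (hγ1 : γ < 1) (hp0 : 0 < p)
    (hp1 : p ≤ 1) (hτ : 0 < τ) {n k : ℕ} (hk : k ≤ n) :
    ∑ j ∈ Finset.Ico k (n + 1),
        (((n : ℝ) + 1) * τ - (j : ℝ) * τ) ^ (p - 1) * |cqWeight γ (j - k)| ≤
      (4 + 2 / p) * (((n : ℝ) + 1) * τ - (k : ℝ) * τ) ^ (p - 1) := by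
  have hm : ((n + 1 - k : ℕ) : ℝ) = n + 1 - k := by
    rw [Nat.cast_sub (by omega)]
    push_cast
    ring
  have hW : ∀ i ∈ Finset.range (n + 1 - k),
      (((n : ℝ) + 1) * τ - ((k + i : ℕ) : ℝ) * τ) ^ (p - 1) * |cqWeight γ (k + i - k)| =
        τ ^ (p - 1) * (|cqWeight γ i| * (((n + 1 - k : ℕ) : ℝ) - i) ^ (p - 1)) := by
    intro i hi
    have hi' : (i : ℝ) ≤ ((n + 1 - k : ℕ) : ℝ) := by
      exact_mod_cast (Finset.mem_range.mp hi).le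
    have hfac : ((n : ℝ) + 1) * τ - ((k + i : ℕ) : ℝ) * τ =
        τ * (((n + 1 - k : ℕ) : ℝ) - i) := by
      rw [hm]
      push_cast
      ring
    rw [hfac, Real.mul_rpow hτ.le (by linarith), Nat.add_sub_cancel_left]
    ring
  have hk' : ((n : ℝ) + 1) * τ - (k : ℝ) * τ = τ * ((n + 1 - k : ℕ) : ℝ) := by
    rw [hm]
    ring
  rw [Finset.sum_Ico_eq_sum_range, Finset.sum_congr rfl hW, ← Finset.mul_sum, hk',
    Real.mul_rpow hτ.le (Nat.cast_nonneg _), mul_left_comm]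
  gcongr
  exact sum_abs_cqWeight_mul_rpow_le hγ0 hγ1 hp0 hp1 _

/-- A weighted inverse-type inequality for the backward Euler CQ operator `∂̄_τ^γ`. -/
theorem weighted_inverse_inequality (α γ : ℝ) (hα0 : 0 < α) (hα1 : α < 1)
    (hγ0 : 0 < γ) (hγ1 : γ < 1) :
    ∃ c : ℝ, 0 < c ∧
      ∀ (V : Type) (_ : NormedAddCommGroup V) (_ : NormedSpace ℝ V),
        ∀ τ : ℝ, 0 < τ → ∀ n : ℕ, 1 ≤ n → ∀ φ : ℕ → V, φ 0 = 0 →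
          τ * ∑ j ∈ Finset.Icc 1 n,
              (((n : ℝ) + 1) * τ - (j : ℝ) * τ) ^ (α / 2 - 1) * ‖cqDeriv γ τ φ j‖
          ≤ c * τ ^ (1 - γ) * ∑ j ∈ Finset.Icc 1 n,
              (((n : ℝ) + 1) * τ - (j : ℝ) * τ) ^ (α / 2 - 1) * ‖φ j‖ := by
  have hp0 : 0 < α / 2 := by positivity
  have hp1 : α / 2 ≤ 1 := by linarith
  refine ⟨4 + 2 / (α / 2), by positivity, ?_⟩
  intro V _ _ τ hτ n _ φ hφ
  set W : ℕ → ℝ := fun j => (((n : ℝ) + 1) * τ - (j : ℝ) * τ) ^ (α / 2 - 1) with hW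
  have hW0 : ∀ j ∈ Finset.Icc 1 n, 0 ≤ W j := by
    intro j hj
    have : (j : ℝ) ≤ n := by exact_mod_cast (Finset.mem_Icc.mp hj).2
    exact Real.rpow_nonneg (by nlinarith) _
  have hswap : ∑ j ∈ Finset.Icc 1 n, W j * ∑ k ∈ Finset.Icc 1 j, |cqWeight γ (j - k)| * ‖φ k‖ =
      ∑ k ∈ Finset.Icc 1 n, (∑ j ∈ Finset.Ico k (n + 1), W j * |cqWeight γ (j - k)|) * ‖φ k‖ := by
    simp only [Finset.mul_sum, Finset.sum_mul, mul_assoc]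
    refine Finset.sum_comm' fun j k => ?_
    simp only [Finset.mem_Icc, Finset.mem_Ico]
    omega
  calc τ * ∑ j ∈ Finset.Icc 1 n, W j * ‖cqDeriv γ τ φ j‖
      ≤ τ * ∑ j ∈ Finset.Icc 1 n, W j *
          (τ ^ (-γ) * ∑ k ∈ Finset.Icc 1 j, |cqWeight γ (j - k)| * ‖φ k‖) := by
        gcongr with j hj
        · exact hW0 j hj
        · exact norm_cqDeriv_le γ hτ hφ j
    _ = τ ^ (1 - γ) * ∑ k ∈ Finset.Icc 1 n,
          (∑ j ∈ Finset.Ico k (n + 1), W j * |cqWeight γ (j - k)|) * ‖φ k‖ := by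
        rw [← hswap, sub_eq_add_neg, Real.rpow_add hτ, Real.rpow_one, mul_assoc,
          Finset.mul_sum _ _ (τ ^ (-γ))]
        simp only [mul_left_comm (τ ^ (-γ))]
    _ ≤ τ ^ (1 - γ) * ∑ k ∈ Finset.Icc 1 n, (4 + 2 / (α / 2)) * W k * ‖φ k‖ := by
        gcongr with k hk
        exact sum_weight_mul_abs_cqWeight_le hγ0 hγ1 hp0 hp1 hτ (Finset.mem_Icc.mp hk).2
    _ = (4 + 2 / (α / 2)) * τ ^ (1 - γ) * ∑ k ∈ Finset.Icc 1 n, W k * ‖φ k‖ := by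
        simp only [mul_assoc, ← Finset.mul_sum]
        ring
end

section
/- Let 0 < α < 1. There exists a constant c > 0, depending only on α, with the following property. Let V be a nontrivial finite-dimensional complex inner product space, A : V → V a self-adjoint positive definite linear operator, v ∈ V, and let u : [0,∞) → V be continuous with u(0) = v, differentiable on (0,∞), such that for every t > 0 the function s ↦ (t-s)^{-α} ‖u'(s)‖ is integrable on (0,t) and (1/Γ(1-α)) ∫_0^t (t-s)^{-α} u'(s) ds + A u(t) = 0. Then for every β ∈ [0,1], every τ > 0 and every integer n ≥ 3, ‖(I + τ^α A)^{1/2} ∂̄_τ^2 u(t_n)‖ ≤ c · t_n^{βα - 2} · ‖A^β v‖, where t_k = kτ and ∂̄_τ^2 u(t_n) = τ^{-2} ( u(t_n) - 2 u(t_{n-1}) + u(t_{n-2}) ). -/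
open scoped ComplexInnerProductSpace

/-- The Caputo derivative `∂_t^α u(t) = (1/Γ(1-α)) ∫_0^t (t-s)^{-α} u'(s) ds`,
expressed through the derivative function `u'`. -/
noncomputable def caputo (α : ℝ) {V : Type} [NormedAddCommGroup V] [NormedSpace ℝ V]
    (u' : ℝ → V) (t : ℝ) : V :=
  (1 / Real.Gamma (1 - α)) • ∫ s in Set.Ioo 0 t, ((t - s) ^ (-α) : ℝ) • u' s

/-- Fractional power `A^β` via the functional (spectral) calculus. -/
noncomputable def opRPow {V : Type} [NormedAddCommGroup V] [InnerProductSpace ℂ V]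
    [FiniteDimensional ℂ V] (A : V →L[ℂ] V) (β : ℝ) : V →L[ℂ] V :=
  cfc (fun x : ℝ => x ^ β) A

/-- The power `(I + τ^α A)^s` of the shifted operator, via the functional (spectral)
calculus. -/
noncomputable def shiftPow {V : Type} [NormedAddCommGroup V] [InnerProductSpace ℂ V]
    [FiniteDimensional ℂ V] (A : V →L[ℂ] V) (τ α s : ℝ) : V →L[ℂ] V :=
  cfc (fun x : ℝ => (1 + τ ^ α * x) ^ s) A

namespace Subdiffusion

open Complex Set MeasureTheory Filter Topology

/-- The density `K` of the measure whose Laplace transform is the relaxation function, i.e. the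
Mittag-Leffler function `t ↦ E_α(-l t^α)`. -/
noncomputable def relaxDensity (α l r : ℝ) : ℝ :=
  Real.sin (Real.pi * α) / Real.pi *
    (l * r ^ (α - 1) / ((r ^ α) ^ 2 + 2 * l * r ^ α * Real.cos (Real.pi * α) + l ^ 2))

theorem half_one_add_cos_mul_le {x y c : ℝ} (hc : c ≤ 1) :
    (1 + c) / 2 * (x + y) ^ 2 ≤ x ^ 2 + 2 * y * x * c + y ^ 2 := by
  nlinarith [mul_nonneg (sub_nonneg.2 hc) (sq_nonneg (x - y))]

theorem neg_one_lt_cos_pi_mul {α : ℝ} (h0 : 0 < α) (h1 : α < 1) :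
    -1 < Real.cos (Real.pi * α) := by
  have := Real.cos_lt_cos_of_nonneg_of_le_pi (x := Real.pi * α) (y := Real.pi)
    (by positivity) le_rfl (by nlinarith [Real.pi_pos])
  simpa using this

theorem norm_sq_exp_add (α l : ℝ) (ζ : ℂ) :
    ‖exp (α * ζ) + l‖ ^ 2 = Real.exp (α * ζ.re) ^ 2
      + 2 * l * Real.exp (α * ζ.re) * Real.cos (α * ζ.im) + l ^ 2 := by
  rw [Complex.sq_norm, Complex.normSq_apply]
  simp [Complex.exp_re, Complex.exp_im]
  nlinarith [Real.sin_sq_add_cos_sq (α * ζ.im)]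

theorem le_norm_sq_exp_add {α l : ℝ} (h0 : 0 < α) (h1 : α < 1) (hl : 0 < l) {ζ : ℂ}
    (hζ : |ζ.im| ≤ Real.pi) :
    (1 + Real.cos (Real.pi * α)) / 2 * (Real.exp (α * ζ.re) + l) ^ 2 ≤ ‖exp (α * ζ) + l‖ ^ 2 := by
  rw [norm_sq_exp_add]
  refine (half_one_add_cos_mul_le (Real.cos_le_one _)).trans ?_
  have : Real.cos (Real.pi * α) ≤ Real.cos (α * ζ.im) := by
    rw [← Real.cos_abs (α * ζ.im), abs_mul, abs_of_pos h0]
    refine Real.cos_le_cos_of_nonneg_of_le_pi (by positivity) ?_ ?_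
    · nlinarith [Real.pi_pos]
    · nlinarith [Real.pi_pos]
  have h2 : 0 < 2 * l * Real.exp (α * ζ.re) := by positivity
  nlinarith

theorem exp_add_ne_zero {α l : ℝ} (h0 : 0 < α) (h1 : α < 1) (hl : 0 < l) {ζ : ℂ}
    (hζ : |ζ.im| ≤ Real.pi) : exp (α * ζ) + l ≠ 0 := by
  intro h
  have := le_norm_sq_exp_add h0 h1 hl hζ
  rw [h] at this
  have h3 := neg_one_lt_cos_pi_mul h0 h1
  have h4 : 0 < (1 + Real.cos (Real.pi * α)) / 2 * (Real.exp (α * ζ.re) + l) ^ 2 := by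
    have : 0 < 1 + Real.cos (Real.pi * α) := by linarith
    positivity
  simp at this
  linarith

/-- A bound for `z^α / (z^α + l)` with `z = exp ζ`, up to the branch cut. -/
theorem norm_exp_div_le {α l : ℝ} (h0 : 0 < α) (h1 : α < 1) (hl : 0 < l) {ζ : ℂ}
    (hζ : |ζ.im| ≤ Real.pi) :
    ‖exp (α * ζ) / (exp (α * ζ) + l)‖ ≤
      (√((1 + Real.cos (Real.pi * α)) / 2))⁻¹ * (Real.exp (α * ζ.re) / (Real.exp (α * ζ.re) + l)) := by
  have h3 := neg_one_lt_cos_pi_mul h0 h1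
  have h4 : 0 < (1 + Real.cos (Real.pi * α)) / 2 := by linarith
  have h5 := Real.sqrt_le_sqrt (le_norm_sq_exp_add h0 h1 hl hζ)
  rw [Real.sqrt_mul h4.le, Real.sqrt_sq (by positivity), Real.sqrt_sq (by positivity)] at h5
  have h6 : 0 < √((1 + Real.cos (Real.pi * α)) / 2) := Real.sqrt_pos.2 h4
  rw [norm_div, Complex.norm_exp]
  have : (α * ζ : ℂ).re = α * ζ.re := by simp
  rw [this]
  calc _ ≤ Real.exp (α * ζ.re) / (√((1 + Real.cos (Real.pi * α)) / 2) * (Real.exp (α * ζ.re) + l)) := by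
        gcongr
    _ = _ := by field_simp

theorem boundary_integral_eq_zero {α l : ℝ} (h0 : 0 < α) (h1 : α < 1) (hl : 0 < l) {p : ℂ}
    (hp : |p.im| < Real.pi) {R : ℝ} (H : ℂ → ℂ)
    (hH : ∀ ζ, ζ ≠ p → H ζ = (exp (α * ζ) / (exp (α * ζ) + l) - exp (α * p) / (exp (α * p) + l)) /
      (exp p - exp ζ)) (hRp : |p.re| < R) :
    (∫ x : ℝ in -R..R, H (x - Real.pi * I)) - (∫ x : ℝ in -R..R, H (x + Real.pi * I)) +
      I * (∫ y : ℝ in -Real.pi..Real.pi, H (R + y * I)) -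
      I * (∫ y : ℝ in -Real.pi..Real.pi, H (-R + y * I)) = 0 := by
  set g : ℂ → ℂ := fun ζ => exp (α * ζ) / (exp (α * ζ) + l) with hg
  set G : ℂ → ℂ := fun ζ => -(dslope g p ζ / dslope exp p ζ) with hG
  have hHG : ∀ ζ, ζ ≠ p → H ζ = G ζ := by
    intro ζ h
    rw [hH ζ h, hG]
    simp only [dslope_of_ne _ h, slope_def_field]
    have : ζ - p ≠ 0 := sub_ne_zero.2 h
    rw [div_div_div_cancel_right₀ this, ← div_neg, neg_sub]
  have hgd : ∀ ζ : ℂ, |ζ.im| ≤ Real.pi → DifferentiableAt ℂ g ζ := by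
    intro ζ h
    have := exp_add_ne_zero h0 h1 hl h
    fun_prop (disch := assumption)
  have hes : ∀ ζ : ℂ, |ζ.im| ≤ Real.pi → dslope exp p ζ ≠ 0 := by
    intro ζ h
    by_cases hζ : ζ = p
    · rw [hζ, dslope_same]; simp
    · rw [dslope_of_ne _ hζ, slope_def_field]
      refine div_ne_zero ?_ (sub_ne_zero.2 hζ)
      intro h2
      rw [sub_eq_zero, Complex.exp_eq_exp_iff_exists_int] at h2
      obtain ⟨n, hn⟩ := h2
      apply hζ
      have him := congrArg Complex.im hn
      simp at him
      rw [abs_lt] at hp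
      rw [abs_le] at h
      have hpi := Real.pi_pos
      have hn1 : (n : ℝ) < 1 := by nlinarith
      have hn2 : (-1 : ℝ) < n := by nlinarith
      have : n = 0 := by
        have a1 : n < 1 := by exact_mod_cast hn1
        have a2 : -1 < n := by exact_mod_cast hn2
        omega
      simpa [this] using hn
  have hcont : ∀ ζ : ℂ, |ζ.im| ≤ Real.pi → ContinuousAt G ζ := by
    intro ζ h
    refine (ContinuousAt.div ?_ ?_ (hes ζ h)).neg
    · by_cases hζ : ζ = p
      · rw [hζ, continuousAt_dslope_same]; exact hgd p hp.le
      · rw [continuousAt_dslope_of_ne hζ]; exact (hgd ζ h).continuousAt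
    · by_cases hζ : ζ = p
      · rw [hζ, continuousAt_dslope_same]; fun_prop
      · rw [continuousAt_dslope_of_ne hζ]; fun_prop
  have hdiff : ∀ ζ : ℂ, |ζ.im| ≤ Real.pi → ζ ≠ p → DifferentiableAt ℂ G ζ := by
    intro ζ h hζ
    refine (DifferentiableAt.div ?_ ?_ (hes ζ h)).neg
    · rw [differentiableAt_dslope_of_ne hζ]; exact hgd ζ h
    · rw [differentiableAt_dslope_of_ne hζ]; fun_prop
  have hpi := Real.pi_pos
  have key := Complex.integral_boundary_rect_eq_zero_of_differentiable_on_off_countable G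
    (-R - Real.pi * I) (R + Real.pi * I) {p} (countable_singleton p)
    (by
      intro ζ hζ
      refine (hcont ζ ?_).continuousWithinAt
      have := hζ.2
      simp [uIcc_of_le (show -Real.pi ≤ Real.pi by linarith)] at this
      exact abs_le.2 this)
    (by
      intro ζ hζ
      refine hdiff ζ ?_ hζ.2
      have := hζ.1.2
      simp [min_eq_left (show -Real.pi ≤ Real.pi by linarith), max_eq_right (show -Real.pi ≤ Real.pi by linarith)] at this
      exact abs_le.2 ⟨this.1.le, this.2.le⟩)
  simp at key
  rw [abs_lt] at hp hRp
  rw [← key]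
  congr 1; congr 1; congr 1
  · refine intervalIntegral.integral_congr fun x _ => ?_
    rw [← sub_eq_add_neg]
    apply hHG
    intro h
    have := congrArg Complex.im h
    simp at this; linarith
  · refine intervalIntegral.integral_congr fun x _ => ?_
    apply hHG
    intro h
    have := congrArg Complex.im h
    simp at this; linarith
  · congr 1
    refine intervalIntegral.integral_congr fun x _ => ?_
    apply hHG
    intro h
    have := congrArg Complex.re h
    simp at this; linarith
  · congr 1
    refine intervalIntegral.integral_congr fun x _ => ?_
    apply hHG
    intro h
    have := congrArg Complex.re h
    simp at this; linarith

theorem mul_div_add_sq_le_rpow {l y γ : ℝ} (hl : 0 < l) (hy : 0 < y) (h1 : -1 ≤ γ) (h2 : γ ≤ 1) :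
    l * y / (l + y) ^ 2 ≤ (l / y) ^ γ := by
  rcases le_total l y with h | h
  · calc l * y / (l + y) ^ 2 ≤ l / y := by
          rw [div_le_div_iff₀ (by positivity) hy]; nlinarith [mul_pos hl hy, mul_pos (mul_pos hl hy) hl, pow_pos hl 3]
      _ = (l / y) ^ (1 : ℝ) := (Real.rpow_one _).symm
      _ ≤ _ := Real.rpow_le_rpow_of_exponent_ge (by positivity) ((div_le_one hy).2 h) h2
  · calc l * y / (l + y) ^ 2 ≤ y / l := by
          rw [div_le_div_iff₀ (by positivity) hl]; nlinarith [mul_pos hl hy, mul_pos (mul_pos hl hy) hy, pow_pos hy 3]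
      _ = (l / y) ^ (-1 : ℝ) := by rw [Real.rpow_neg_one, inv_div]
      _ ≤ _ := Real.rpow_le_rpow_of_exponent_le ((one_le_div hy).2 h) h1

/-- The constant in the power bounds for `relaxDensity`. -/
noncomputable def relaxConst (α : ℝ) : ℝ :=
  Real.sin (Real.pi * α) / Real.pi * (2 / (1 + Real.cos (Real.pi * α)))

theorem sin_pi_mul_pos {α : ℝ} (h0 : 0 < α) (h1 : α < 1) : 0 < Real.sin (Real.pi * α) :=
  Real.sin_pos_of_pos_of_lt_pi (by positivity) (by nlinarith [Real.pi_pos])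

theorem relaxConst_pos {α : ℝ} (h0 : 0 < α) (h1 : α < 1) : 0 < relaxConst α := by
  have h3 := neg_one_lt_cos_pi_mul h0 h1
  have h4 := sin_pi_mul_pos h0 h1
  have : 0 < 1 + Real.cos (Real.pi * α) := by linarith
  unfold relaxConst
  have := Real.pi_pos
  positivity

theorem relaxDensity_denom_pos {α l y : ℝ} (h0 : 0 < α) (h1 : α < 1) (hl : 0 < l) (hy : 0 < y) :
    0 < y ^ 2 + 2 * l * y * Real.cos (Real.pi * α) + l ^ 2 := by
  have h3 := neg_one_lt_cos_pi_mul h0 h1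
  have h4 : 0 < (1 + Real.cos (Real.pi * α)) / 2 := by linarith
  have := half_one_add_cos_mul_le (x := y) (y := l) (Real.cos_le_one (Real.pi * α))
  have : 0 < (1 + Real.cos (Real.pi * α)) / 2 * (y + l) ^ 2 := by positivity
  linarith

theorem relaxDensity_nonneg {α l r : ℝ} (h0 : 0 < α) (h1 : α < 1) (hl : 0 < l) (hr : 0 < r) :
    0 ≤ relaxDensity α l r := by
  have := relaxDensity_denom_pos h0 h1 hl (Real.rpow_pos_of_pos hr α)
  have := sin_pi_mul_pos h0 h1
  have := Real.pi_pos
  unfold relaxDensity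
  positivity

theorem relaxDensity_le {α l r γ : ℝ} (h0 : 0 < α) (h1 : α < 1) (hl : 0 < l) (hr : 0 < r)
    (hγ : -1 ≤ γ) (hγ' : γ ≤ 1) :
    relaxDensity α l r ≤ relaxConst α * l ^ γ * r ^ (-1 - α * γ) := by
  have h3 := neg_one_lt_cos_pi_mul h0 h1
  have h4 : 0 < 1 + Real.cos (Real.pi * α) := by linarith
  have h5 := sin_pi_mul_pos h0 h1
  have hpi := Real.pi_pos
  have hy := Real.rpow_pos_of_pos hr α
  have hb := mul_div_add_sq_le_rpow hl hy hγ hγ'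
  have hD := half_one_add_cos_mul_le (x := r ^ α) (y := l) (Real.cos_le_one (Real.pi * α))
  have e1 : (l / r ^ α) ^ γ = l ^ γ * r ^ (-(α * γ)) := by
    rw [Real.div_rpow hl.le hy.le, ← Real.rpow_mul hr.le, Real.rpow_neg hr.le, div_eq_mul_inv]
  have e2 : r ^ (-1 - α * γ) = r⁻¹ * r ^ (-(α * γ)) := by
    rw [sub_eq_add_neg, Real.rpow_add hr, Real.rpow_neg_one]
  calc relaxDensity α l r ≤ Real.sin (Real.pi * α) / Real.pi *
      (l * r ^ (α - 1) / ((1 + Real.cos (Real.pi * α)) / 2 * (r ^ α + l) ^ 2)) := by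
        unfold relaxDensity
        gcongr
    _ = relaxConst α * r⁻¹ * (l * r ^ α / (l + r ^ α) ^ 2) := by
        rw [Real.rpow_sub_one hr.ne', relaxConst, add_comm l]
        field_simp
    _ ≤ relaxConst α * r⁻¹ * (l / r ^ α) ^ γ := by
        have := relaxConst_pos h0 h1
        gcongr
    _ = _ := by rw [e1, e2]; ring

theorem measurable_relaxDensity (α l : ℝ) : Measurable (relaxDensity α l) := by
  unfold relaxDensity
  fun_prop

theorem integrableOn_relaxDensity {α l : ℝ} (h0 : 0 < α) (h1 : α < 1) (hl : 0 < l) :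
    IntegrableOn (relaxDensity α l) (Ioi 0) := by
  have hm := (measurable_relaxDensity α l).aestronglyMeasurable (μ := volume)
  rw [← Ioc_union_Ioi_eq_Ioi (zero_le_one' ℝ)]
  refine IntegrableOn.union ?_ ?_
  · have h := (intervalIntegral.intervalIntegrable_rpow' (a := 0) (b := 1) (r := α - 1)
      (by linarith)).1.const_mul (relaxConst α * l ^ (-1 : ℝ))
    refine Integrable.mono' h hm.restrict ?_
    filter_upwards [ae_restrict_mem measurableSet_Ioc] with r hr
    rw [Real.norm_of_nonneg (relaxDensity_nonneg h0 h1 hl hr.1)]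
    refine (relaxDensity_le (γ := -1) h0 h1 hl hr.1 le_rfl (by norm_num)).trans (le_of_eq ?_)
    congr 2; ring
  · have h := (integrableOn_Ioi_rpow_of_lt (a := -1 - α) (c := 1)
      (by linarith) one_pos).const_mul (relaxConst α * l ^ (1 : ℝ))
    refine Integrable.mono' h hm.restrict ?_
    filter_upwards [ae_restrict_mem measurableSet_Ioi] with r hr
    have hr0 : 0 < r := one_pos.trans hr
    rw [Real.norm_of_nonneg (relaxDensity_nonneg h0 h1 hl hr0)]
    refine (relaxDensity_le (γ := 1) h0 h1 hl hr0 (by norm_num) le_rfl).trans (le_of_eq ?_)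
    congr 2; ring

theorem tendsto_vertical_integral (F : ℝ → ℝ → ℂ) (a : ℂ) (B : ℝ → ℝ)
    (hF : ∀ᶠ R in atTop, IntervalIntegrable (F R) volume (-Real.pi) Real.pi)
    (hB : ∀ᶠ R in atTop, ∀ y, |y| ≤ Real.pi → ‖F R y - a‖ ≤ B R)
    (hB0 : Tendsto B atTop (𝓝 0)) :
    Tendsto (fun R => ∫ y in -Real.pi..Real.pi, F R y) atTop (𝓝 (2 * Real.pi * a)) := by
  rw [tendsto_iff_norm_sub_tendsto_zero]
  refine squeeze_zero' (Eventually.of_forall fun _ => norm_nonneg _)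
    (g := fun R => B R * |Real.pi - -Real.pi|) ?_ (by simpa using hB0.mul_const _)
  filter_upwards [hF, hB] with R h1 h2
  have : (∫ y in -Real.pi..Real.pi, F R y) - 2 * Real.pi * a
      = ∫ y in -Real.pi..Real.pi, (F R y - a) := by
    rw [intervalIntegral.integral_sub h1 (by simp), intervalIntegral.integral_const, real_smul]
    push_cast; ring
  rw [this]
  refine intervalIntegral.norm_integral_le_of_norm_le_const fun y hy => h2 y ?_
  rw [uIoc_of_le (by linarith [Real.pi_pos])] at hy
  exact abs_le.2 ⟨hy.1.le, hy.2⟩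

theorem integral_Ioi_eq_integral_exp (f : ℝ → ℂ) :
    ∫ r in Ioi (0 : ℝ), f r = ∫ x : ℝ, (Real.exp x : ℂ) * f (Real.exp x) := by
  have := integral_image_eq_integral_abs_deriv_smul (s := univ) MeasurableSet.univ
    (fun x _ => (Real.hasDerivAt_exp x).hasDerivWithinAt) (Real.exp_injective.injOn) f
  rw [image_univ, Real.range_exp] at this
  simpa using this

theorem integrable_exp_mul_of_integrableOn_Ioi {f : ℝ → ℂ} (hf : IntegrableOn f (Ioi (0 : ℝ))) :
    Integrable fun x : ℝ => (Real.exp x : ℂ) * f (Real.exp x) := by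
  have := integrableOn_image_iff_integrableOn_abs_deriv_smul (s := univ) MeasurableSet.univ
    (fun x _ => (Real.hasDerivAt_exp x).hasDerivWithinAt) (Real.exp_injective.injOn) f
  rw [image_univ, Real.range_exp] at this
  simpa using this.1 hf

theorem integrableOn_relaxDensity_div {α l : ℝ} (h0 : 0 < α) (h1 : α < 1) (hl : 0 < l) {z : ℂ}
    (hz : 0 < z.re) : IntegrableOn (fun r : ℝ => (relaxDensity α l r : ℂ) / (z + r)) (Ioi 0) := by
  refine Integrable.mono' ((integrableOn_relaxDensity h0 h1 hl).mul_const z.re⁻¹) ?_ ?_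
  · have := measurable_relaxDensity α l
    exact Measurable.aestronglyMeasurable (by fun_prop)
  · filter_upwards [ae_restrict_mem measurableSet_Ioi] with r hr
    have hr : 0 < r := hr
    rw [norm_div, norm_real, Real.norm_of_nonneg (relaxDensity_nonneg h0 h1 hl hr), div_eq_mul_inv]
    have : z.re ≤ ‖z + r‖ := by
      calc z.re ≤ (z + r).re := by simp [hr.le]
        _ ≤ _ := Complex.re_le_norm _
    have := relaxDensity_nonneg h0 h1 hl hr
    gcongr

theorem exp_div_sub_exp_div {α l : ℝ} (h0 : 0 < α) (h1 : α < 1) (hl : 0 < l) (x : ℝ) :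
    exp (α * (x + Real.pi * I)) / (exp (α * (x + Real.pi * I)) + l) -
      exp (α * (x - Real.pi * I)) / (exp (α * (x - Real.pi * I)) + l) =
    2 * Real.pi * I * (Real.exp x * relaxDensity α l (Real.exp x)) := by
  have hpi := Real.pi_pos
  have n1 := exp_add_ne_zero h0 h1 hl (ζ := x + Real.pi * I) (by simp [abs_of_pos hpi])
  have n2 := exp_add_ne_zero h0 h1 hl (ζ := x - Real.pi * I) (by simp [abs_of_pos hpi])
  have e1 : exp (α * (x + Real.pi * I)) = (Real.exp x ^ α : ℝ) *
      (Real.cos (Real.pi * α) + Real.sin (Real.pi * α) * I) := by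
    rw [← Real.exp_mul, mul_add, exp_add, ofReal_cos, ofReal_sin, ← exp_mul_I]
    push_cast; congr 2 <;> ring
  have e2 : exp (α * (x - Real.pi * I)) = (Real.exp x ^ α : ℝ) *
      (Real.cos (Real.pi * α) - Real.sin (Real.pi * α) * I) := by
    have : (α : ℂ) * (x - Real.pi * I) = α * x + (-(Real.pi * α : ℝ) : ℝ) * I := by push_cast; ring
    rw [← Real.exp_mul, this, exp_add, exp_mul_I, ← ofReal_cos, ← ofReal_sin, Real.cos_neg, Real.sin_neg]
    push_cast; congr 2 <;> ring
  have hy : 0 < Real.exp x ^ α := by positivity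
  have hD := relaxDensity_denom_pos h0 h1 hl hy
  rw [div_sub_div _ _ n1 n2]
  rw [relaxDensity, Real.rpow_sub_one (Real.exp_pos x).ne']
  rw [e1, e2] at *
  set y := Real.exp x ^ α
  set c := Real.cos (Real.pi * α) with hc
  set s := Real.sin (Real.pi * α) with hs
  have hcs : (s : ℂ) ^ 2 + c ^ 2 = 1 := by
    rw [hs, hc]; exact_mod_cast Real.sin_sq_add_cos_sq (Real.pi * α)
  have hD' : ((y * (c + s * I) + l) * (y * (c - s * I) + l) : ℂ) =
      ((y ^ 2 + 2 * l * y * c + l ^ 2 : ℝ) : ℂ) := by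
    push_cast
    linear_combination (y : ℂ) ^ 2 * hcs - (y : ℂ) ^ 2 * (s : ℂ) ^ 2 * I_sq
  rw [hD']
  have hD2 : ((y ^ 2 + 2 * l * y * c + l ^ 2 : ℝ) : ℂ) ≠ 0 := by exact_mod_cast hD.ne'
  push_cast at hD2 ⊢
  have hpi' : (Real.pi : ℂ) ≠ 0 := by exact_mod_cast hpi.ne'
  have hx' : exp (x : ℂ) ≠ 0 := exp_ne_zero _
  field_simp
  ring

theorem integral_relaxDensity_div {α l : ℝ} (h0 : 0 < α) (h1 : α < 1) (hl : 0 < l) {z : ℂ}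
    (hz : 0 < z.re) :
    ∫ r in Ioi (0 : ℝ), (relaxDensity α l r : ℂ) / (z + r) = z ^ (α : ℂ) / (z ^ (α : ℂ) + l) / z := by
  have hz0 : z ≠ 0 := fun h => by simp [h] at hz
  have hpi := Real.pi_pos
  set p := log z with hp
  have hep : exp p = z := exp_log hz0
  have hpim : |p.im| < Real.pi := by
    rw [hp, log_im]
    have := (abs_arg_lt_pi_div_two_iff (z := z)).2 (Or.inl hz)
    linarith
  set g : ℂ → ℂ := fun ζ => exp (α * ζ) / (exp (α * ζ) + l) with hg
  set c := g p with hc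
  have hcz : c = z ^ (α : ℂ) / (z ^ (α : ℂ) + l) := by
    rw [hc, hg]; simp only; rw [cpow_def_of_ne_zero hz0, mul_comm]
  set H : ℂ → ℂ := fun ζ => (g ζ - c) / (z - exp ζ) with hH
  set M := (√((1 + Real.cos (Real.pi * α)) / 2))⁻¹ with hM
  have hM0 : 0 ≤ M := by positivity
  have hgb : ∀ ζ : ℂ, |ζ.im| ≤ Real.pi → ‖g ζ‖ ≤ M := fun ζ h => by
    refine (norm_exp_div_le h0 h1 hl h).trans ?_
    refine mul_le_of_le_one_right hM0 ?_
    rw [div_le_one (by positivity)]; linarith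
  have hgb' : ∀ ζ : ℂ, |ζ.im| ≤ Real.pi → ‖g ζ‖ ≤ M * (Real.exp (α * ζ.re) / l) := fun ζ h => by
    refine (norm_exp_div_le h0 h1 hl h).trans ?_
    gcongr
    linarith [Real.exp_pos (α * ζ.re)]
  have hgc : ∀ ζ : ℂ, |ζ.im| ≤ Real.pi → ContinuousAt g ζ := by
    intro ζ h
    have := exp_add_ne_zero h0 h1 hl h
    fun_prop (disch := assumption)
  have hHc : ∀ ζ : ℂ, |ζ.im| ≤ Real.pi → z ≠ exp ζ → ContinuousAt H ζ := by
    intro ζ h h'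
    have := hgc ζ h
    have := sub_ne_zero.2 h'
    fun_prop (disch := assumption)
  have hbd := fun R hR => boundary_integral_eq_zero h0 h1 hl hpim (R := R) H
    (fun ζ _ => by rw [hep]) hR
  -- vertical sides
  have hRlarge : ∀ᶠ R : ℝ in atTop, ‖z‖ < Real.exp R :=
    Real.tendsto_exp_atTop.eventually_gt_atTop _
  have hLlarge : ∀ᶠ R : ℝ in atTop, Real.exp (-R) < ‖z‖ :=
    (Real.tendsto_exp_neg_atTop_nhds_zero).eventually_lt_const (norm_pos_iff.2 hz0)
  have hright : Tendsto (fun R : ℝ => ∫ y in -Real.pi..Real.pi, H (R + y * I)) atTop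
      (𝓝 (2 * Real.pi * 0)) := by
    refine tendsto_vertical_integral (fun R y => H (R + y * I)) 0
      (fun R => (M + ‖c‖) / (Real.exp R - ‖z‖)) ?_ ?_ ?_
    · filter_upwards [hRlarge] with R hR
      refine ContinuousOn.intervalIntegrable fun y hy => ContinuousAt.continuousWithinAt ?_
      rw [uIcc_of_le (by linarith)] at hy
      refine (hHc _ (by simpa using abs_le.2 hy) ?_).comp (f := fun y : ℝ => (R + y * I : ℂ))
        (by fun_prop)
      intro h
      have := congrArg norm h
      rw [norm_exp] at this
      simp at this; linarith
    · filter_upwards [hRlarge] with R hR y hy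
      have h2 := hgb (R + y * I) (by simpa using hy)
      have h3 := norm_sub_norm_le (exp (R + y * I)) z
      rw [norm_exp, norm_sub_rev] at h3
      simp only [sub_zero, hH, norm_div]
      simp at h3
      have := norm_sub_le (g (R + y * I)) c
      gcongr
      · linarith
      · linarith
    · refine Tendsto.div_atTop tendsto_const_nhds ?_
      exact tendsto_atTop_add_const_right _ _ Real.tendsto_exp_atTop
  have hleft : Tendsto (fun R : ℝ => ∫ y in -Real.pi..Real.pi, H (-R + y * I)) atTop
      (𝓝 (2 * Real.pi * (-(c / z)))) := by
    refine tendsto_vertical_integral (fun R y => H (-R + y * I)) _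
      (fun R => (M * (Real.exp (α * -R) / l) + ‖c‖ * Real.exp (-R) / ‖z‖)
        / (‖z‖ - Real.exp (-R))) ?_ ?_ ?_
    · filter_upwards [hLlarge] with R hR
      refine ContinuousOn.intervalIntegrable fun y hy => ContinuousAt.continuousWithinAt ?_
      rw [uIcc_of_le (by linarith)] at hy
      refine (hHc _ (by simpa using abs_le.2 hy) ?_).comp (f := fun y : ℝ => (-R + y * I : ℂ))
        (by fun_prop)
      intro h
      have := congrArg norm h
      rw [norm_exp] at this
      simp at this; linarith
    · filter_upwards [hLlarge] with R hR y hy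
      have h2 := hgb' (-R + y * I) (by simpa using hy)
      have h3 := norm_sub_norm_le z (exp (-R + y * I))
      rw [norm_exp] at h3
      have h4 : ‖exp (-R + y * I)‖ = Real.exp (-R) := by rw [norm_exp]; simp
      simp at h3 h2
      have h5 : z - exp (-R + y * I) ≠ 0 := fun h => by
        rw [h] at h3; simp at h3; linarith
      have : H (-R + y * I) - -(c / z)
          = (g (-R + y * I) - c * exp (-R + y * I) / z) / (z - exp (-R + y * I)) := by
        simp only [hH]; field_simp; ring
      rw [this, norm_div]
      have := norm_sub_le (g (-R + y * I)) (c * exp (-R + y * I) / z)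
      rw [norm_div (c * _) z, norm_mul, h4] at this
      have e : Real.exp (α * -R) = Real.exp (-(α * R)) := by ring_nf
      rw [e]
      gcongr
      · linarith
      · linarith
    · have t1 := Real.tendsto_exp_neg_atTop_nhds_zero
      have t2 : Tendsto (fun R => Real.exp (α * -R)) atTop (𝓝 0) := by
        have := t1.comp (tendsto_id.const_mul_atTop h0)
        refine this.congr fun R => ?_
        simp
      have := (((t2.div_const l).const_mul M).add ((t1.const_mul ‖c‖).div_const ‖z‖)).div
        (t1.const_sub ‖z‖) (by simpa using hz0)
      simpa [Pi.div_def] using this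
  -- horizontal sides
  have hep1 : ∀ x : ℝ, exp (x + Real.pi * I) = -Real.exp x := fun x => by
    rw [exp_add, exp_pi_mul_I]; push_cast; ring
  have hep2 : ∀ x : ℝ, exp (x - Real.pi * I) = -Real.exp x := fun x => by
    rw [exp_sub, exp_pi_mul_I]; push_cast; ring
  have hne : ∀ x : ℝ, z + Real.exp x ≠ 0 := fun x h => by
    have := congrArg re h
    simp only [add_re, ofReal_re, zero_re] at this
    linarith [Real.exp_pos x]
  have hhor : ∀ x : ℝ, H (x + Real.pi * I) - H (x - Real.pi * I) =
      2 * Real.pi * I * (Real.exp x * (relaxDensity α l (Real.exp x) / (z + Real.exp x))) := by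
    intro x
    simp only [hH]
    rw [hep1, hep2, sub_neg_eq_add, ← sub_div, sub_sub_sub_cancel_right, mul_div_assoc',
      mul_div_assoc', ← exp_div_sub_exp_div h0 h1 hl]
  have hii1 : ∀ R, IntervalIntegrable (fun x : ℝ => H (x + Real.pi * I)) volume (-R) R := fun R => by
    refine Continuous.intervalIntegrable (continuous_iff_continuousAt.2 fun x => ?_) _ _
    refine (hHc _ (by simp [abs_of_pos hpi]) ?_).comp (f := fun x : ℝ => (x + Real.pi * I : ℂ))
      (by fun_prop)
    rw [hep1]
    intro h
    exact hne x (by rw [h]; ring)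
  have hii2 : ∀ R, IntervalIntegrable (fun x : ℝ => H (x - Real.pi * I)) volume (-R) R := fun R => by
    refine Continuous.intervalIntegrable (continuous_iff_continuousAt.2 fun x => ?_) _ _
    refine (hHc _ (by simp [abs_of_pos hpi]) ?_).comp (f := fun x : ℝ => (x - Real.pi * I : ℂ))
      (by fun_prop)
    rw [hep2]
    intro h
    exact hne x (by rw [h]; ring)
  have hint := integrable_exp_mul_of_integrableOn_Ioi (integrableOn_relaxDensity_div h0 h1 hl hz)
  have hlim := intervalIntegral_tendsto_integral hint tendsto_neg_atTop_atBot tendsto_id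
  have hlim2 := (hright.const_mul I).sub (hleft.const_mul I)
  have heq : ∀ᶠ R : ℝ in atTop,
      (2 * Real.pi * I) * (∫ x in -R..R, (Real.exp x : ℂ) *
        ((relaxDensity α l (Real.exp x) : ℂ) / (z + Real.exp x))) =
      I * (∫ y in -Real.pi..Real.pi, H (R + y * I)) -
        I * ∫ y in -Real.pi..Real.pi, H (-R + y * I) := by
    filter_upwards [eventually_gt_atTop |p.re|] with R hR
    rw [← intervalIntegral.integral_const_mul]
    simp_rw [← hhor]
    rw [intervalIntegral.integral_sub (hii1 R) (hii2 R)]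
    linear_combination -hbd R hR
  have := tendsto_nhds_unique ((hlim.const_mul (2 * Real.pi * I : ℂ)).congr' heq) hlim2
  rw [integral_Ioi_eq_integral_exp, ← hcz]
  have h2 : (2 * Real.pi * I : ℂ) ≠ 0 := by simp [hpi.ne']
  apply mul_left_cancel₀ h2
  rw [this]; ring

theorem integrableOn_rpow_mul_exp_neg_mul {a b : ℝ} (ha : 0 < a) (hb : 0 < b) :
    IntegrableOn (fun t : ℝ => t ^ (a - 1) * Real.exp (-(b * t))) (Ioi 0) := by
  have := integrableOn_rpow_mul_exp_neg_mul_rpow (p := 1) (s := a - 1) (b := b) (by linarith)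
    one_pos hb
  simpa using this

theorem integrableOn_rpow_mul_cexp {a : ℝ} (ha : 0 < a) {z : ℂ} (hz : 0 < z.re) :
    IntegrableOn (fun t : ℝ => exp (-z * t) * ((t ^ (a - 1) : ℝ) : ℂ)) (Ioi 0) := by
  refine Integrable.mono' (integrableOn_rpow_mul_exp_neg_mul ha hz) ?_ ?_
  · exact Measurable.aestronglyMeasurable (by fun_prop)
  · filter_upwards [ae_restrict_mem measurableSet_Ioi] with t ht
    have ht : 0 < t := ht
    rw [norm_mul, norm_real, norm_exp, Real.norm_of_nonneg (by positivity), mul_comm]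
    simp

/-- The Laplace transform of `t ^ (a - 1)` at a complex point. -/
theorem integral_cexp_mul_rpow {a : ℝ} (ha : 0 < a) {z : ℂ} (hz : 0 < z.re) :
    ∫ t in Ioi (0 : ℝ), exp (-z * t) * ((t ^ (a - 1) : ℝ) : ℂ) = Real.Gamma a * z ^ (-a : ℂ) := by
  set μ : Measure ℝ := (volume.restrict (Ioi 0)).withDensity
    (fun t => ENNReal.ofReal (t ^ (a - 1))) with hμ
  set X : ℝ → ℝ := fun t => -t with hX
  have hm : Measurable (fun t : ℝ => ENNReal.ofReal (t ^ (a - 1))) := by fun_prop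
  have hset : Ioi 0 ⊆ interior (ProbabilityTheory.integrableExpSet X μ) := by
    refine interior_maximal (fun s hs => ?_) isOpen_Ioi
    have hs : 0 < s := hs
    simp only [ProbabilityTheory.integrableExpSet, mem_ofPred_eq, hμ]
    rw [integrable_withDensity_iff_integrable_smul' hm (by simp)]
    refine (integrableOn_rpow_mul_exp_neg_mul ha hs).congr_fun (fun t ht => ?_) measurableSet_Ioi
    have ht : 0 < t := ht
    simp only [smul_eq_mul, hX]
    rw [ENNReal.toReal_ofReal (by positivity), mul_neg]
  have hF : ∀ z : ℂ, ProbabilityTheory.complexMGF X μ z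
      = ∫ t in Ioi (0 : ℝ), exp (-z * t) * ((t ^ (a - 1) : ℝ) : ℂ) := by
    intro z
    rw [ProbabilityTheory.complexMGF, hμ, integral_withDensity_eq_integral_toReal_smul hm (by simp)]
    refine setIntegral_congr_fun measurableSet_Ioi fun t ht => ?_
    have ht : 0 < t := ht
    simp only [hX]
    rw [ENNReal.toReal_ofReal (by positivity), real_smul, mul_comm]
    push_cast; ring_nf
  have hU : IsPreconnected {z : ℂ | 0 < z.re} := (convex_halfSpace_re_gt 0).isPreconnected
  have hf : AnalyticOnNhd ℂ (ProbabilityTheory.complexMGF X μ) {z : ℂ | 0 < z.re} :=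
    ProbabilityTheory.analyticOnNhd_complexMGF.mono fun z hz => hset hz
  have hg : AnalyticOnNhd ℂ (fun z : ℂ => Real.Gamma a * z ^ (-a : ℂ)) {z : ℂ | 0 < z.re} := by
    refine DifferentiableOn.analyticOnNhd (fun z hz => ?_) (isOpen_lt continuous_const continuous_re)
    have : z ∈ slitPlane := Or.inl hz
    exact DifferentiableAt.differentiableWithinAt (by fun_prop (disch := assumption))
  have hreal : ∀ x : ℝ, 0 < x → ProbabilityTheory.complexMGF X μ x = Real.Gamma a * (x : ℂ) ^ (-a : ℂ) := by
    intro x hx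
    have h := congrArg (fun y : ℝ => (y : ℂ)) (Real.integral_rpow_mul_exp_neg_mul_Ioi ha hx)
    rw [← integral_complex_ofReal] at h
    rw [hF]
    have e : ((1 / x) ^ a : ℝ) = x ^ (-a) := by
      rw [one_div, Real.inv_rpow hx.le, Real.rpow_neg hx.le]
    rw [e] at h
    push_cast [ofReal_cpow hx.le] at h
    rw [mul_comm _ (_ ^ _), ← h]
    refine setIntegral_congr_fun measurableSet_Ioi fun t ht => ?_
    rw [mul_comm]; ring_nf
  have := hf.eqOn_of_preconnected_of_frequently_eq hg hU (z₀ := 1) (by simp) (by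
    have ht : Tendsto (fun x : ℝ => (x : ℂ)) (𝓝[≠] 1) (𝓝[≠] 1) := by
      refine tendsto_nhdsWithin_of_tendsto_nhds_of_eventually_within _ ?_ ?_
      · exact (continuous_ofReal.tendsto' 1 1 (by simp)).mono_left nhdsWithin_le_nhds
      · filter_upwards [self_mem_nhdsWithin] with x hx
        simpa using hx
    refine ht.frequently (Eventually.frequently ?_)
    filter_upwards [mem_nhdsWithin_of_mem_nhds (lt_mem_nhds one_pos)] with x hx
    exact hreal x hx)
  rw [← hF]
  exact this hz

/-- The relaxation function `t ↦ E_α(-l t^α)`, as the Laplace transform of `relaxDensity`. -/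
noncomputable def relaxation (α l t : ℝ) : ℝ :=
  ∫ r in Ioi (0 : ℝ), Real.exp (-(r * t)) * relaxDensity α l r

theorem norm_exp_mul_relaxDensity_le {α l t r : ℝ} (h0 : 0 < α) (h1 : α < 1) (hl : 0 < l)
    (ht : 0 ≤ t) (hr : 0 < r) :
    ‖Real.exp (-(r * t)) * relaxDensity α l r‖ ≤ relaxDensity α l r := by
  have := relaxDensity_nonneg h0 h1 hl hr
  rw [Real.norm_of_nonneg (by positivity)]
  exact mul_le_of_le_one_left this (Real.exp_le_one_iff.2 (by simp only [neg_nonpos]; positivity))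

theorem continuousOn_relaxation {α l : ℝ} (h0 : 0 < α) (h1 : α < 1) (hl : 0 < l) :
    ContinuousOn (relaxation α l) (Ioi 0) := by
  intro t ht
  refine ContinuousAt.continuousWithinAt ?_
  have hm := measurable_relaxDensity α l
  refine continuousAt_of_dominated (bound := relaxDensity α l) ?_ ?_
    (integrableOn_relaxDensity h0 h1 hl) ?_
  · exact Eventually.of_forall fun s => Measurable.aestronglyMeasurable (by fun_prop)
  · filter_upwards [lt_mem_nhds ht] with s hs
    filter_upwards [ae_restrict_mem measurableSet_Ioi] with r hr
    exact norm_exp_mul_relaxDensity_le h0 h1 hl (le_of_lt hs) hr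
  · exact Eventually.of_forall fun r => by fun_prop

theorem abs_relaxation_le {α l t : ℝ} (h0 : 0 < α) (h1 : α < 1) (hl : 0 < l) (ht : 0 ≤ t) :
    |relaxation α l t| ≤ ∫ r in Ioi (0 : ℝ), relaxDensity α l r := by
  rw [← Real.norm_eq_abs, relaxation]
  refine norm_integral_le_of_norm_le (integrableOn_relaxDensity h0 h1 hl) ?_
  filter_upwards [ae_restrict_mem measurableSet_Ioi] with r hr
  exact norm_exp_mul_relaxDensity_le h0 h1 hl ht hr

theorem integral_cexp_mul_relaxation {α l : ℝ} (h0 : 0 < α) (h1 : α < 1) (hl : 0 < l) {z : ℂ}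
    (hz : 0 < z.re) :
    ∫ t in Ioi (0 : ℝ), exp (-z * t) * (relaxation α l t : ℂ)
      = z ^ (α : ℂ) / (z ^ (α : ℂ) + l) / z := by
  rw [← integral_relaxDensity_div h0 h1 hl hz]
  have hm := measurable_relaxDensity α l
  have hint : Integrable (Function.uncurry fun (t r : ℝ) =>
      exp (-(z + r) * t) * (relaxDensity α l r : ℂ))
      ((volume.restrict (Ioi 0)).prod (volume.restrict (Ioi 0))) := by
    have hb : IntegrableOn (fun t : ℝ => Real.exp (-z.re * t)) (Ioi 0) :=
      exp_neg_integrableOn_Ioi 0 hz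
    refine Integrable.mono' (hb.mul_prod (integrableOn_relaxDensity h0 h1 hl)) ?_ ?_
    · exact Measurable.aestronglyMeasurable (by fun_prop)
    · rw [Measure.prod_restrict]
      filter_upwards [ae_restrict_mem (measurableSet_Ioi.prod measurableSet_Ioi)] with p hp
      have hp1 : 0 < p.1 := hp.1
      have hp2 : 0 < p.2 := hp.2
      have := relaxDensity_nonneg h0 h1 hl hp2
      simp only [Function.uncurry]
      rw [norm_mul, norm_exp, norm_real, Real.norm_of_nonneg this]
      gcongr
      have := mul_pos hp2 hp1
      simp only [mul_re, neg_re, add_re, ofReal_re, neg_im, add_im, ofReal_im]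
      nlinarith
  calc _ = ∫ t in Ioi (0 : ℝ), ∫ r in Ioi (0 : ℝ), exp (-(z + r) * t) * (relaxDensity α l r : ℂ) := by
        refine integral_congr_ae (Eventually.of_forall fun t => ?_)
        simp only [relaxation]
        rw [← integral_complex_ofReal, ← integral_const_mul]
        refine integral_congr_ae (Eventually.of_forall fun r => ?_)
        simp only
        push_cast
        rw [← mul_assoc, ← exp_add]
        ring_nf
    _ = ∫ r in Ioi (0 : ℝ), ∫ t in Ioi (0 : ℝ), exp (-(z + r) * t) * (relaxDensity α l r : ℂ) :=
        integral_integral_swap hint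
    _ = _ := by
        refine setIntegral_congr_fun measurableSet_Ioi fun r hr => ?_
        have hr : 0 < r := hr
        rw [integral_mul_const, integral_exp_mul_complex_Ioi (by simp; linarith)]
        simp only [ofReal_zero, mul_zero, exp_zero, neg_div_neg_eq]
        ring

theorem eq_zero_of_laplace_eq_zero {f : ℝ → ℂ} {x : ℝ} (hf : ContinuousOn f (Ioi 0))
    (hi : IntegrableOn (fun t : ℝ => exp (-(x : ℂ) * t) * f t) (Ioi 0))
    (h : ∀ z : ℂ, z.re = x → ∫ t in Ioi (0 : ℝ), exp (-z * t) * f t = 0) {t : ℝ} (ht : 0 < t) :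
    f t = 0 := by
  set g : ℝ → ℂ := (Ioi 0).indicator (fun t : ℝ => exp (-(x : ℂ) * t) * f t) with hg
  have hgi : Integrable g := hi.integrable_indicator measurableSet_Ioi
  have hfour : FourierTransform.fourier g = 0 := by
    ext ξ
    rw [Real.fourier_real_eq_integral_exp_smul]
    have := h (x + (2 * Real.pi * ξ : ℝ) * I) (by simp)
    rw [← integral_indicator measurableSet_Ioi] at this
    rw [Pi.zero_apply, ← this]
    congr 1 with s
    by_cases hs : s ∈ Ioi (0 : ℝ)
    · rw [hg, indicator_of_mem hs, indicator_of_mem hs, smul_eq_mul, ← mul_assoc, ← exp_add]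
      push_cast; ring_nf
    · rw [hg, indicator_of_notMem hs, indicator_of_notMem hs, smul_zero]
  have hev : g =ᶠ[𝓝 t] fun t : ℝ => exp (-(x : ℂ) * t) * f t := by
    filter_upwards [lt_mem_nhds ht] with s hs
    rw [hg, indicator_of_mem (by exact hs)]
  have hcont : ContinuousAt g t := by
    refine ContinuousAt.congr ?_ hev.symm
    have := hf.continuousAt (lt_mem_nhds ht)
    fun_prop
  have := hgi.fourierInv_fourier_eq (by rw [hfour]; exact integrable_zero _ _ _) hcont
  rw [hfour] at this
  have h0 : g t = 0 := by
    rw [← this, Real.fourierInv_eq']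
    simp
  rw [hev.self_of_nhds] at h0
  simpa using h0

theorem norm_le_of_volterra {α l : ℝ} (h0 : 0 < α) (hl : 0 < l) {w : ℝ → ℂ}
    (hw : ContinuousOn w (Ici 0))
    (hv : ∀ t, 0 < t → w t = w 0 - (l / Real.Gamma α : ℝ) *
      ∫ s in 0..t, ((s ^ (α - 1) : ℝ) : ℂ) * w (t - s)) {t : ℝ} (ht : 0 ≤ t) :
    ‖w t‖ ≤ 2 * ‖w 0‖ * Real.exp ((2 * l) ^ (1 / α) * t) := by
  set σ := (2 * l) ^ (1 / α) with hσ
  have hσ0 : 0 < σ := by positivity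
  have hG := Real.Gamma_pos_of_pos h0
  have hσα : (1 / σ) ^ α = 1 / (2 * l) := by
    rw [Real.div_rpow zero_le_one hσ0.le, Real.one_rpow, hσ, ← Real.rpow_mul (by positivity),
      one_div_mul_cancel h0.ne', Real.rpow_one]
  obtain ⟨m, hm, hmax⟩ := isCompact_Icc.exists_isMaxOn (s := Icc 0 t) (nonempty_Icc.2 ht)
    (f := fun s => Real.exp (-(σ * s)) * ‖w s‖)
    (ContinuousOn.mul (by fun_prop) (hw.mono Icc_subset_Ici_self).norm)
  set M := Real.exp (-(σ * m)) * ‖w m‖ with hM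
  have hM0 : 0 ≤ M := by positivity
  have hle : ∀ s ∈ Icc 0 t, ‖w s‖ ≤ M * Real.exp (σ * s) := by
    intro s hs
    have : Real.exp (-(σ * s)) * ‖w s‖ ≤ M := hmax hs
    calc ‖w s‖ = Real.exp (-(σ * s)) * ‖w s‖ * Real.exp (σ * s) := by
          rw [mul_right_comm, ← Real.exp_add]; simp
      _ ≤ _ := by gcongr
  have hML : M ≤ ‖w 0‖ + M / 2 := by
    rcases hm.1.eq_or_lt with h | h
    · rw [hM, ← h]; simp; positivity
    have hki := (integrableOn_rpow_mul_exp_neg_mul h0 hσ0)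
    have hb : ‖∫ s in 0..m, ((s ^ (α - 1) : ℝ) : ℂ) * w (m - s)‖ ≤
        ∫ s in 0..m, M * Real.exp (σ * m) * (s ^ (α - 1) * Real.exp (-(σ * s))) := by
      refine intervalIntegral.norm_integral_le_of_norm_le h.le ?_ ?_
      · refine Eventually.of_forall fun s hs => ?_
        have hs0 : 0 < s := hs.1
        rw [norm_mul, norm_real, Real.norm_of_nonneg (by positivity)]
        have := hle (m - s) ⟨by linarith [hs.2], by linarith [hm.2]⟩
        calc s ^ (α - 1) * ‖w (m - s)‖ ≤ s ^ (α - 1) * (M * Real.exp (σ * (m - s))) := by gcongr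
          _ = _ := by
            rw [mul_sub, sub_eq_add_neg (σ * m), Real.exp_add]; ring
      · refine IntervalIntegrable.const_mul ?_ _
        rw [intervalIntegrable_iff_integrableOn_Ioc_of_le h.le]
        exact hki.mono_set Ioc_subset_Ioi_self
    have hb2 : ∫ s in 0..m, s ^ (α - 1) * Real.exp (-(σ * s)) ≤ 1 / (2 * l) * Real.Gamma α := by
      rw [← hσα, ← Real.integral_rpow_mul_exp_neg_mul_Ioi h0 hσ0,
        intervalIntegral.integral_of_le h.le]
      refine setIntegral_mono_set hki ?_ Ioc_subset_Ioi_self.eventuallyLE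
      filter_upwards [ae_restrict_mem measurableSet_Ioi] with s hs
      have hs : 0 < s := hs
      simp only [Pi.zero_apply]; positivity
    rw [intervalIntegral.integral_const_mul] at hb
    have h3 : ‖w m‖ ≤ ‖w 0‖ + M * Real.exp (σ * m) / 2 := by
      calc ‖w m‖ ≤ ‖w 0‖ + ‖((l / Real.Gamma α : ℝ) : ℂ) *
            ∫ s in 0..m, ((s ^ (α - 1) : ℝ) : ℂ) * w (m - s)‖ := by
            rw [hv m h]; exact norm_sub_le _ _
        _ ≤ ‖w 0‖ + l / Real.Gamma α * (M * Real.exp (σ * m) * (1 / (2 * l) * Real.Gamma α)) := by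
            rw [norm_mul, norm_real, Real.norm_of_nonneg (by positivity)]
            gcongr
            exact hb.trans (by gcongr)
        _ = _ := by field_simp
    calc M ≤ Real.exp (-(σ * m)) * (‖w 0‖ + M * Real.exp (σ * m) / 2) := by rw [hM]; gcongr
      _ = Real.exp (-(σ * m)) * ‖w 0‖ + M / 2 * (Real.exp (-(σ * m)) * Real.exp (σ * m)) := by ring
      _ = Real.exp (-(σ * m)) * ‖w 0‖ + M / 2 := by rw [← Real.exp_add]; simp
      _ ≤ _ := by
        gcongr
        refine mul_le_of_le_one_left (norm_nonneg _) (Real.exp_le_one_iff.2 ?_)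
        simp only [neg_nonpos]; positivity
  calc ‖w t‖ ≤ M * Real.exp (σ * t) := hle t ⟨ht, le_rfl⟩
    _ ≤ _ := by gcongr; linarith

theorem eq_relaxation_of_volterra {α l : ℝ} (h0 : 0 < α) (h1 : α < 1) (hl : 0 < l) {w : ℝ → ℂ}
    (hw : ContinuousOn w (Ici 0))
    (hv : ∀ t, 0 < t → w t = w 0 - (l / Real.Gamma α : ℝ) *
      ∫ s in 0..t, ((s ^ (α - 1) : ℝ) : ℂ) * w (t - s)) {t : ℝ} (ht : 0 < t) :
    w t = w 0 * relaxation α l t := by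
  have hgrowth := fun {t : ℝ} (ht : 0 ≤ t) => norm_le_of_volterra h0 hl hw hv ht
  have hG := Real.Gamma_pos_of_pos h0
  set σ := (2 * l) ^ (1 / α) with hσ
  have hσ0 : 0 < σ := by positivity
  have hwi : ∀ z : ℂ, σ < z.re → IntegrableOn (fun t : ℝ => exp (-z * t) * w t) (Ioi 0) := by
    intro z hz
    have hb : IntegrableOn (fun t : ℝ => 2 * ‖w 0‖ * Real.exp (-(z.re - σ) * t)) (Ioi 0) :=
      (exp_neg_integrableOn_Ioi 0 (sub_pos.2 hz)).const_mul _
    refine Integrable.mono' hb ?_ ?_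
    · refine ContinuousOn.aestronglyMeasurable ?_ measurableSet_Ioi
      exact ContinuousOn.mul (by fun_prop) (hw.mono Ioi_subset_Ici_self)
    · filter_upwards [ae_restrict_mem measurableSet_Ioi] with t ht
      rw [norm_mul, norm_exp]
      calc _ ≤ Real.exp (-z * t).re * (2 * ‖w 0‖ * Real.exp (σ * t)) := by
            gcongr; exact hgrowth (le_of_lt ht)
        _ = 2 * ‖w 0‖ * (Real.exp (-z * t).re * Real.exp (σ * t)) := by ring
        _ = _ := by
          rw [← Real.exp_add]; congr 2; simp; ring
  have hri : ∀ z : ℂ, σ < z.re →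
      IntegrableOn (fun t : ℝ => exp (-z * t) * (relaxation α l t : ℂ)) (Ioi 0) := by
    intro z hz
    have hb := (exp_neg_integrableOn_Ioi 0 (hσ0.trans hz)).mul_const
      (∫ r in Ioi (0 : ℝ), relaxDensity α l r)
    refine Integrable.mono' hb ?_ ?_
    · refine ContinuousOn.aestronglyMeasurable ?_ measurableSet_Ioi
      exact ContinuousOn.mul (by fun_prop)
        (continuous_ofReal.comp_continuousOn (continuousOn_relaxation h0 h1 hl))
    · filter_upwards [ae_restrict_mem measurableSet_Ioi] with t ht
      rw [norm_mul, norm_exp, norm_real]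
      have := abs_relaxation_le h0 h1 hl (le_of_lt ht)
      rw [Real.norm_eq_abs]
      gcongr
      simp
  have hlap : ∀ z : ℂ, σ < z.re → ∫ t in Ioi (0 : ℝ), exp (-z * t) * w t =
      w 0 * (z ^ (α : ℂ) / (z ^ (α : ℂ) + l) / z) := by
    intro z hz
    have hz0 : 0 < z.re := hσ0.trans hz
    have hzne : z ≠ 0 := fun h => by simp [h] at hz0
    have hconv := integral_posConvolution (integrableOn_rpow_mul_cexp h0 hz0) (hwi z hz)
      (ContinuousLinearMap.mul ℝ ℂ)
    simp only [ContinuousLinearMap.mul_apply'] at hconv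
    rw [integral_cexp_mul_rpow h0 hz0] at hconv
    have hpt : ∀ t ∈ Ioi (0 : ℝ), ((l / Real.Gamma α : ℝ) : ℂ) * (∫ s in 0..t,
        exp (-z * s) * ((s ^ (α - 1) : ℝ) : ℂ) * (exp (-z * (t - s : ℝ)) * w (t - s))) =
        w 0 * exp (-z * t) - exp (-z * t) * w t := by
      intro t ht
      have e : (∫ s in 0..t,
        exp (-z * s) * ((s ^ (α - 1) : ℝ) : ℂ) * (exp (-z * (t - s : ℝ)) * w (t - s))) =
        exp (-z * t) * ∫ s in 0..t, ((s ^ (α - 1) : ℝ) : ℂ) * w (t - s) := by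
        rw [← intervalIntegral.integral_const_mul]
        refine intervalIntegral.integral_congr fun s _ => ?_
        have : exp (-z * t) = exp (-z * s) * exp (-z * (t - s : ℝ)) := by
          rw [← exp_add]; push_cast; ring_nf
        rw [this]; ring
      rw [e]
      linear_combination exp (-z * t) * hv t ht
    have hint := setIntegral_congr_fun (μ := volume) measurableSet_Ioi hpt
    rw [integral_const_mul, hconv, integral_sub
      ((integrableOn_exp_mul_complex_Ioi (by simpa using hz0) 0).const_mul _) (hwi z hz),
      integral_const_mul, integral_exp_mul_complex_Ioi (by simpa using hz0)] at hint
    simp only [ofReal_zero, mul_zero, exp_zero, neg_div_neg_eq] at hint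
    have hden : z ^ (α : ℂ) + l ≠ 0 := by
      rw [cpow_def_of_ne_zero hzne, mul_comm]
      refine exp_add_ne_zero h0 h1 hl ?_
      rw [log_im]
      exact abs_arg_le_pi z
    have hza : z ^ (α : ℂ) ≠ 0 := by simp [cpow_eq_zero_iff, hzne]
    rw [cpow_neg] at hint
    have hG' : (Real.Gamma α : ℂ) ≠ 0 := by exact_mod_cast hG.ne'
    push_cast at hint
    set W := ∫ t in Ioi (0 : ℝ), exp (-z * t) * w t
    field_simp at hint ⊢
    linear_combination hint
  have hz := eq_zero_of_laplace_eq_zero (f := fun t => w t - w 0 * relaxation α l t) (x := σ + 1)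
    ?_ ?_ ?_ ht
  · exact sub_eq_zero.1 hz
  · exact (hw.mono Ioi_subset_Ici_self).sub (continuousOn_const.mul
      (continuous_ofReal.comp_continuousOn (continuousOn_relaxation h0 h1 hl)))
  · have := (hwi ((σ + 1 : ℝ) : ℂ) (by simp)).sub ((hri ((σ + 1 : ℝ) : ℂ) (by simp)).const_mul (w 0))
    refine this.congr (Eventually.of_forall fun t => ?_)
    simp only [Pi.sub_apply]; ring
  · intro z hz
    have hz' : σ < z.re := by rw [hz]; linarith
    have e : ∀ t : ℝ, exp (-z * t) * (w t - w 0 * relaxation α l t) =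
        exp (-z * t) * w t - w 0 * (exp (-z * t) * relaxation α l t) := fun t => by ring
    simp_rw [e]
    rw [integral_sub (hwi z hz') ((hri z hz').const_mul _), integral_const_mul, hlap z hz',
      integral_cexp_mul_relaxation h0 h1 hl (hσ0.trans hz'), sub_self]

theorem setIntegral_rpow_mul_rpow_eq {α r t : ℝ} (h0 : 0 < α) (h1 : α < 1) (hrt : r < t) :
    ∫ s in Ioo r t, (t - s) ^ (α - 1) * (s - r) ^ (-α) = Real.Gamma α * Real.Gamma (1 - α) := by
  have hb := Complex.betaIntegral_scaled (1 - α : ℂ) (α : ℂ) (sub_pos.2 hrt)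
  have hG := Complex.Gamma_mul_Gamma_eq_betaIntegral (s := (1 - α : ℂ)) (t := (α : ℂ))
    (by simpa using h1) (by simpa using h0)
  have e1 : (1 - α + α : ℂ) = 1 := by ring
  rw [e1, Complex.Gamma_one, one_mul] at hG
  rw [e1, sub_self, cpow_zero, one_mul, ← hG] at hb
  rw [← integral_Ioc_eq_integral_Ioo, ← intervalIntegral.integral_of_le hrt.le]
  have h2 := intervalIntegral.integral_comp_sub_right
    (a := r) (b := t) (fun x => (t - r - x) ^ (α - 1) * x ^ (-α)) r
  simp only [sub_self, sub_sub_sub_cancel_right] at h2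
  rw [h2]
  apply ofReal_injective
  rw [← intervalIntegral.integral_ofReal]
  push_cast
  rw [← Complex.Gamma_ofReal, ← Complex.Gamma_ofReal]
  push_cast
  rw [mul_comm, ← hb]
  refine intervalIntegral.integral_congr fun x hx => ?_
  rw [uIcc_of_le (by linarith)] at hx
  rw [ofReal_cpow hx.1, ofReal_cpow (by linarith [hx.2]), mul_comm]
  push_cast
  congr 2
  ring

theorem integrableOn_rpow_mul_rpow {α r t : ℝ} (h0 : 0 < α) (h1 : α < 1) :
    IntegrableOn (fun s => (t - s) ^ (α - 1) * (s - r) ^ (-α)) (Ioo r t) := by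
  rcases lt_or_ge r t with hrt | hrt
  · refine Integrable.of_integral_ne_zero ?_
    rw [setIntegral_rpow_mul_rpow_eq h0 h1 hrt]
    exact (mul_pos (Real.Gamma_pos_of_pos h0) (Real.Gamma_pos_of_pos (by linarith))).ne'
  · simp [Ioo_eq_empty_of_le hrt]

theorem integrableOn_of_rpow_mul {α t : ℝ} (h0 : 0 < α) {f : ℝ → ℂ} (hf : Measurable f)
    (hi : IntegrableOn (fun s => (t - s) ^ (-α) * ‖f s‖) (Ioo 0 t)) : IntegrableOn f (Ioo 0 t) := by
  refine Integrable.mono' (hi.const_mul (t ^ α)) hf.aestronglyMeasurable ?_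
  filter_upwards [ae_restrict_mem measurableSet_Ioo] with s hs
  have hts : 0 < t - s := sub_pos.2 hs.2
  have ht : 0 < t := hs.1.trans hs.2
  rw [← mul_assoc, Real.rpow_neg hts.le]
  refine le_mul_of_one_le_left (norm_nonneg _) ?_
  rw [← div_eq_mul_inv, one_le_div (by positivity)]
  exact Real.rpow_le_rpow hts.le (by linarith [hs.1]) h0.le

theorem integral_rpow_mul_integral_rpow_mul {α t : ℝ} (h0 : 0 < α) (h1 : α < 1)
    {f : ℝ → ℂ} (hf : Measurable f)
    (hi : IntegrableOn f (Ioo 0 t)) :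
    ∫ s in Ioo 0 t, (((t - s) ^ (α - 1) : ℝ) : ℂ) * ∫ r in Ioo 0 s, (((s - r) ^ (-α) : ℝ) : ℂ) * f r
      = Real.Gamma α * Real.Gamma (1 - α) * ∫ r in Ioo 0 t, f r := by
  set k : ℝ → ℝ → ℝ := fun r s => (t - s) ^ (α - 1) * (s - r) ^ (-α) with hk
  set F : ℝ → ℝ → ℂ := fun s r => (Ioi r).indicator (fun s => (k r s : ℂ) * f r) s with hF
  have hFm : Measurable (Function.uncurry F) := by
    have : Function.uncurry F = {p : ℝ × ℝ | p.2 < p.1}.indicator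
        (fun p => (k p.2 p.1 : ℂ) * f p.2) := by
      ext ⟨s, r⟩; simp [F, indicator]
    rw [this]
    refine Measurable.indicator ?_ (measurableSet_lt measurable_snd measurable_fst)
    simp only [hk]
    fun_prop
  have hset : ∀ {r : ℝ}, r ∈ Ioo 0 t → Ioo 0 t ∩ Ioi r = Ioo r t := by
    intro r hr; ext s
    simp only [mem_inter_iff, mem_Ioo, mem_Ioi]
    exact ⟨fun h => ⟨h.2, h.1.2⟩, fun h => ⟨⟨hr.1.trans h.1, h.2⟩, h.1⟩⟩
  have hset' : ∀ {s : ℝ}, s ∈ Ioo 0 t → Ioo 0 t ∩ Iio s = Ioo 0 s := by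
    intro r hr; ext s
    simp only [mem_inter_iff, mem_Ioo, mem_Iio]
    exact ⟨fun h => ⟨h.1.1, h.2⟩, fun h => ⟨⟨h.1, h.2.trans hr.2⟩, h.2⟩⟩
  have hnorm : ∀ r ∈ Ioo 0 t, ∫ s in Ioo 0 t, ‖F s r‖ =
      Real.Gamma α * Real.Gamma (1 - α) * ‖f r‖ := by
    intro r hr
    have e : ∀ s, ‖F s r‖ = (Ioi r).indicator (fun s => ‖(k r s : ℂ) * f r‖) s := fun s => by
      simp only [hF, indicator]; split_ifs <;> simp
    simp_rw [e]
    rw [setIntegral_indicator measurableSet_Ioi, hset hr,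
      ← setIntegral_rpow_mul_rpow_eq h0 h1 hr.2, ← integral_mul_const]
    refine setIntegral_congr_fun measurableSet_Ioo fun s hs => ?_
    have h1 : 0 < t - s := sub_pos.2 hs.2
    have h2 : 0 < s - r := sub_pos.2 hs.1
    simp only [norm_mul, norm_real, hk]
    rw [Real.norm_of_nonneg (by positivity), Real.norm_of_nonneg (by positivity)]
  have hint : Integrable (Function.uncurry F)
      ((volume.restrict (Ioo 0 t)).prod (volume.restrict (Ioo 0 t))) := by
    rw [integrable_prod_iff' hFm.aestronglyMeasurable]
    constructor
    · filter_upwards [ae_restrict_mem measurableSet_Ioo] with r hr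
      simp only [Function.uncurry_apply_pair, hF]
      refine (integrable_indicator_iff measurableSet_Ioi).2 ?_
      rw [IntegrableOn, Measure.restrict_restrict measurableSet_Ioi, inter_comm, hset hr]
      exact ((integrableOn_rpow_mul_rpow h0 h1).ofReal).mul_const _
    · refine (hi.norm.const_mul (Real.Gamma α * Real.Gamma (1 - α))).congr ?_
      filter_upwards [ae_restrict_mem measurableSet_Ioo] with r hr
      exact (hnorm r hr).symm
  have hswap := integral_integral_swap hint
  have hl : ∀ s ∈ Ioo 0 t, ∫ r in Ioo 0 t, F s r =
      (((t - s) ^ (α - 1) : ℝ) : ℂ) * ∫ r in Ioo 0 s, (((s - r) ^ (-α) : ℝ) : ℂ) * f r := by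
    intro s hs
    have e : ∀ r, F s r = (Iio s).indicator (fun r => (((t - s) ^ (α - 1) : ℝ) : ℂ) *
        ((((s - r) ^ (-α) : ℝ) : ℂ) * f r)) r := fun r => by
      simp only [hF, hk, indicator, mem_Ioi, mem_Iio]; split_ifs <;> push_cast <;> ring
    simp_rw [e]
    rw [setIntegral_indicator measurableSet_Iio, hset' hs, integral_const_mul]
  have hr : ∀ r ∈ Ioo 0 t, ∫ s in Ioo 0 t, F s r =
      Real.Gamma α * Real.Gamma (1 - α) * f r := by
    intro r hr
    simp only [hF]
    rw [setIntegral_indicator measurableSet_Ioi, hset hr, integral_mul_const,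
      integral_complex_ofReal, setIntegral_rpow_mul_rpow_eq h0 h1 hr.2]
    push_cast; ring
  rw [setIntegral_congr_fun measurableSet_Ioo hl, setIntegral_congr_fun measurableSet_Ioo hr,
    integral_const_mul] at hswap
  exact hswap

/-- The scalar equation `∂_t^α w + l w = 0` has only the solution `w 0 * relaxation α l`. -/
theorem eq_relaxation_of_caputo {α l : ℝ} (h0 : 0 < α) (h1 : α < 1) (hl : 0 < l) {w w' : ℝ → ℂ}
    (hw : ContinuousOn w (Ici 0)) (hm : Measurable w') (hd : ∀ t, 0 < t → HasDerivAt w (w' t) t)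
    (hi : ∀ t, 0 < t → IntegrableOn (fun s => (t - s) ^ (-α) * ‖w' s‖) (Ioo 0 t))
    (he : ∀ t, 0 < t → ((1 / Real.Gamma (1 - α) : ℝ) : ℂ) *
      (∫ s in Ioo 0 t, (((t - s) ^ (-α) : ℝ) : ℂ) * w' s) + l * w t = 0)
    {t : ℝ} (ht : 0 < t) : w t = w 0 * relaxation α l t := by
  refine eq_relaxation_of_volterra h0 h1 hl hw (fun t ht => ?_) ht
  have hG : (Real.Gamma α : ℂ) ≠ 0 := by exact_mod_cast (Real.Gamma_pos_of_pos h0).ne'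
  have hG' : (Real.Gamma (1 - α) : ℂ) ≠ 0 := by
    exact_mod_cast (Real.Gamma_pos_of_pos (sub_pos.2 h1)).ne'
  have hi' := integrableOn_of_rpow_mul h0 hm (hi t ht)
  have hftc : ∫ s in Ioo 0 t, w' s = w t - w 0 := by
    rw [← integral_Ioc_eq_integral_Ioo, ← intervalIntegral.integral_of_le ht.le]
    refine intervalIntegral.integral_eq_sub_of_hasDerivAt_of_le ht.le
      (hw.mono Icc_subset_Ici_self) (fun s hs => hd s hs.1) ?_
    rwa [intervalIntegrable_iff_integrableOn_Ioo_of_le ht.le]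
  have hmain := integral_rpow_mul_integral_rpow_mul h0 h1 hm hi'
  have hpt : ∀ s ∈ Ioo 0 t, (((t - s) ^ (α - 1) : ℝ) : ℂ) *
      ∫ r in Ioo 0 s, (((s - r) ^ (-α) : ℝ) : ℂ) * w' r =
      -(Real.Gamma (1 - α) * l) * ((((t - s) ^ (α - 1) : ℝ) : ℂ) * w s) := by
    intro s hs
    have := he s hs.1
    push_cast at this
    field_simp at this
    linear_combination (((t - s) ^ (α - 1) : ℝ) : ℂ) * this
  rw [setIntegral_congr_fun measurableSet_Ioo hpt, integral_const_mul, hftc,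
    ← integral_Ioc_eq_integral_Ioo, ← intervalIntegral.integral_of_le ht.le] at hmain
  have hsub := intervalIntegral.integral_comp_sub_left (a := 0) (b := t)
    (fun s => ((s ^ (α - 1) : ℝ) : ℂ) * w (t - s)) t
  simp only [sub_sub_cancel, sub_self, sub_zero] at hsub
  rw [← hsub]
  push_cast
  field_simp
  refine mul_left_cancel₀ hG' ?_
  linear_combination -hmain

theorem Gamma_le_two {x : ℝ} (h1 : 1 ≤ x) (h3 : x ≤ 3) : Real.Gamma x ≤ 2 := by
  have h := Real.convexOn_Gamma.le_max_of_mem_Icc (x := 1) (y := 3) (z := x)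
    (by simp) (by simp) ⟨h1, h3⟩
  have e : Real.Gamma 3 = 2 := by
    have := Real.Gamma_nat_eq_factorial 2
    norm_num [Nat.factorial] at this ⊢
  rw [e, Real.Gamma_one] at h
  simpa using h

theorem abs_second_difference_relaxation_le {α l γ t τ : ℝ} (h0 : 0 < α) (h1 : α < 1) (hl : 0 < l)
    (hγ : -1 ≤ γ) (hγ' : γ ≤ 1) (ht : 0 < t) (hτ : 0 < τ) :
    |relaxation α l (t + 2 * τ) - 2 * relaxation α l (t + τ) + relaxation α l t| ≤
      τ ^ 2 * (2 * relaxConst α * l ^ γ * t ^ (α * γ - 2)) := by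
  have hαγ : |α * γ| ≤ 1 := by
    rw [abs_mul, abs_of_pos h0]
    exact mul_le_one₀ h1.le (abs_nonneg _) (abs_le.2 ⟨hγ, hγ'⟩)
  obtain ⟨hlo, hhi⟩ := abs_le.1 hαγ
  have hi : ∀ {t : ℝ}, 0 ≤ t →
      IntegrableOn (fun r => Real.exp (-(r * t)) * relaxDensity α l r) (Ioi 0) := by
    intro t ht
    refine (integrableOn_relaxDensity h0 h1 hl).mono' ?_ ?_
    · have := measurable_relaxDensity α l
      exact Measurable.aestronglyMeasurable (by fun_prop)
    · filter_upwards [ae_restrict_mem measurableSet_Ioi] with r hr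
      exact norm_exp_mul_relaxDensity_le h0 h1 hl ht hr
  have e : relaxation α l (t + 2 * τ) - 2 * relaxation α l (t + τ) + relaxation α l t =
      ∫ r in Ioi (0 : ℝ), Real.exp (-(r * t)) * (1 - Real.exp (-(r * τ))) ^ 2 *
        relaxDensity α l r := by
    simp only [relaxation]
    have h1 := (hi (t := t + τ) (by positivity)).const_mul 2
    rw [← integral_const_mul, ← integral_sub (hi (by positivity)) h1,
      ← integral_add (by exact (hi (by positivity)).sub h1) (hi ht.le)]
    refine integral_congr_ae (Eventually.of_forall fun r => ?_)
    have e1 : Real.exp (-(r * (t + 2 * τ))) = Real.exp (-(r * t)) * Real.exp (-(r * τ)) ^ 2 := by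
      rw [sq, ← Real.exp_add, ← Real.exp_add]; ring_nf
    have e2 : Real.exp (-(r * (t + τ))) = Real.exp (-(r * t)) * Real.exp (-(r * τ)) := by
      rw [← Real.exp_add]; ring_nf
    simp only [e1, e2]
    ring
  have ha : 0 < 2 - α * γ := by linarith
  have hk := integrableOn_rpow_mul_exp_neg_mul ha ht
  have hbound : ∀ r ∈ Ioi (0 : ℝ),
      ‖Real.exp (-(r * t)) * (1 - Real.exp (-(r * τ))) ^ 2 * relaxDensity α l r‖ ≤
      τ ^ 2 * (relaxConst α * l ^ γ) * (r ^ (2 - α * γ - 1) * Real.exp (-(t * r))) := by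
    intro r hr
    have hr : 0 < r := hr
    have hK := relaxDensity_nonneg h0 h1 hl hr
    rw [Real.norm_of_nonneg (by positivity)]
    have hsq : (1 - Real.exp (-(r * τ))) ^ 2 ≤ (r * τ) ^ 2 := by
      have h1 : Real.exp (-(r * τ)) ≤ 1 := Real.exp_le_one_iff.2 (by simp only [neg_nonpos]; positivity)
      have h2 := Real.add_one_le_exp (-(r * τ))
      exact pow_le_pow_left₀ (by linarith) (by linarith) 2
    have e3 : r ^ (2 - α * γ - 1) = r ^ 2 * r ^ (-1 - α * γ) := by
      rw [← Real.rpow_natCast, ← Real.rpow_add hr]; congr 1; push_cast; ring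
    calc _ ≤ Real.exp (-(r * t)) * (r * τ) ^ 2 * (relaxConst α * l ^ γ * r ^ (-1 - α * γ)) := by
          gcongr
          exact relaxDensity_le h0 h1 hl hr hγ hγ'
      _ = _ := by rw [e3, mul_comm t r]; ring
  rw [e, ← Real.norm_eq_abs]
  have hc := (relaxConst_pos h0 h1)
  calc _ ≤ ∫ r in Ioi (0 : ℝ), τ ^ 2 * (relaxConst α * l ^ γ) *
        (r ^ (2 - α * γ - 1) * Real.exp (-(t * r))) := by
        refine norm_integral_le_of_norm_le (hk.const_mul _) ?_
        filter_upwards [ae_restrict_mem measurableSet_Ioi] with r hr using hbound r hr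
    _ = τ ^ 2 * (relaxConst α * l ^ γ) * (t ^ (α * γ - 2) * Real.Gamma (2 - α * γ)) := by
        rw [integral_const_mul, Real.integral_rpow_mul_exp_neg_mul_Ioi ha ht, one_div,
          Real.inv_rpow ht.le, ← Real.rpow_neg ht.le, neg_sub]
    _ ≤ τ ^ 2 * (relaxConst α * l ^ γ) * (t ^ (α * γ - 2) * 2) := by
        gcongr
        exact Gamma_le_two (by linarith) (by linarith)
    _ = _ := by ring

theorem weighted_second_difference_relaxation_le {α l β τ : ℝ} (h0 : 0 < α) (h1 : α < 1)
    (hl : 0 < l) (hβ : 0 ≤ β) (hβ' : β ≤ 1) (hτ : 0 < τ) {n : ℕ} (hn : 3 ≤ n) :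
    (1 + τ ^ α * l) ^ (1 / 2 : ℝ) * ((τ ^ 2)⁻¹ * |relaxation α l (n * τ) -
      2 * relaxation α l ((n - 1) * τ) + relaxation α l ((n - 2) * τ)|) ≤
      108 * relaxConst α * ((n : ℝ) * τ) ^ (β * α - 2) * l ^ β := by
  have hc := relaxConst_pos h0 h1
  have hn' : (3 : ℝ) ≤ n := by exact_mod_cast hn
  set T := (n : ℝ) * τ with hT
  have hT0 : 0 < T := by positivity
  have hτT : τ ≤ T := by nlinarith
  have htT : T / 3 ≤ (n - 2) * τ := by nlinarith
  have hn2 : 0 < ((n : ℝ) - 2) * τ := by nlinarith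
  set D := (τ ^ 2)⁻¹ * |relaxation α l T -
      2 * relaxation α l ((n - 1) * τ) + relaxation α l ((n - 2) * τ)| with hD
  have hD0 : 0 ≤ D := by positivity
  have hγ : ∀ γ : ℝ, -1 ≤ γ → γ ≤ 1 → D ≤ 54 * relaxConst α * l ^ γ * T ^ (α * γ - 2) := by
    intro γ h h'
    have hαγ : |α * γ| ≤ 1 := by
      rw [abs_mul, abs_of_pos h0]
      exact mul_le_one₀ h1.le (abs_nonneg _) (abs_le.2 ⟨h, h'⟩)
    obtain ⟨hlo, hhi⟩ := abs_le.1 hαγ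
    have := abs_second_difference_relaxation_le h0 h1 hl h h' hn2 hτ
    have e1 : ((n : ℝ) - 2) * τ + 2 * τ = T := by rw [hT]; ring
    have e2 : ((n : ℝ) - 2) * τ + τ = (n - 1) * τ := by ring
    rw [e1, e2, ← inv_mul_le_iff₀ (by positivity)] at this
    have hpow : (((n : ℝ) - 2) * τ) ^ (α * γ - 2) ≤ 27 * T ^ (α * γ - 2) := by
      calc _ ≤ (T / 3) ^ (α * γ - 2) :=
            Real.rpow_le_rpow_of_nonpos (by positivity) htT (by linarith)
        _ = 3 ^ (2 - α * γ) * T ^ (α * γ - 2) := by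
            rw [Real.div_rpow hT0.le (by norm_num), div_eq_mul_inv,
              ← Real.rpow_neg (by norm_num), neg_sub, mul_comm]
        _ ≤ 3 ^ (3 : ℝ) * T ^ (α * γ - 2) := by
            gcongr
            · norm_num
            · linarith
        _ = _ := by norm_num
    calc D ≤ _ := this
      _ ≤ 2 * relaxConst α * l ^ γ * (27 * T ^ (α * γ - 2)) := by gcongr
      _ = _ := by ring
  have hsqrt : (1 + τ ^ α * l) ^ (1 / 2 : ℝ) ≤ 1 + T ^ (α / 2) * l ^ (1 / 2 : ℝ) := by
    calc (1 + τ ^ α * l) ^ (1 / 2 : ℝ) ≤ 1 ^ (1 / 2 : ℝ) + (τ ^ α * l) ^ (1 / 2 : ℝ) :=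
          Real.rpow_add_le_add_rpow zero_le_one (by positivity) (by norm_num) (by norm_num)
      _ = 1 + τ ^ (α / 2) * l ^ (1 / 2 : ℝ) := by
          rw [Real.one_rpow, Real.mul_rpow (by positivity) hl.le, ← Real.rpow_mul hτ.le]
          ring_nf
      _ ≤ _ := by gcongr
  have ha := hγ β (by linarith) hβ'
  have hb := hγ (β - 1 / 2) (by linarith) (by linarith)
  calc _ ≤ (1 + T ^ (α / 2) * l ^ (1 / 2 : ℝ)) * D := by gcongr
    _ = D + T ^ (α / 2) * l ^ (1 / 2 : ℝ) * D := by ring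
    _ ≤ 54 * relaxConst α * l ^ β * T ^ (α * β - 2) + T ^ (α / 2) * l ^ (1 / 2 : ℝ) *
        (54 * relaxConst α * l ^ (β - 1 / 2) * T ^ (α * (β - 1 / 2) - 2)) := by gcongr
    _ = 54 * relaxConst α * l ^ β * T ^ (α * β - 2) + 54 * relaxConst α *
        (l ^ (1 / 2 : ℝ) * l ^ (β - 1 / 2)) * (T ^ (α / 2) * T ^ (α * (β - 1 / 2) - 2)) := by ring
    _ = _ := by
        rw [← Real.rpow_add hl, ← Real.rpow_add hT0]
        ring_nf

section FunctionalCalculus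

variable {V : Type} [NormedAddCommGroup V] [InnerProductSpace ℂ V]

theorem aeval_apply_of_apply_eq_smul {A : V →L[ℂ] V} {x : ℝ} {e : V} (h : A e = (x : ℂ) • e)
    (q : Polynomial ℝ) : Polynomial.aeval A q e = ((q.eval x : ℝ) : ℂ) • e := by
  induction q using Polynomial.induction_on' with
  | add p q hp hq => simp [hp, hq, add_smul]
  | monomial n a =>
    have hpow : ∀ n : ℕ, (A ^ n) e = ((x : ℂ) ^ n) • e := by
      intro n
      induction n with
      | zero => simp
      | succ k ih => rw [pow_succ', mul_apply_eq_comp, ih, map_smul, h, smul_smul, pow_succ]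
    rw [Polynomial.aeval_monomial, Polynomial.eval_monomial, mul_apply_eq_comp, hpow,
      Algebra.algebraMap_eq_smul_one]
    push_cast
    rw [mul_smul]
    exact RCLike.real_smul_eq_coe_smul (K := ℂ) _ _

variable [FiniteDimensional ℂ V]

theorem finite_real_spectrum (A : V →L[ℂ] V) : (spectrum ℝ A).Finite := by
  have : FiniteDimensional ℝ (V →L[ℂ] V) := FiniteDimensional.complexToReal _
  have hint : IsIntegral ℝ A := Algebra.IsIntegral.isIntegral A
  refine (Multiset.finite_toSet (minpoly ℝ A).roots).subset fun x hx => ?_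
  have h := spectrum.subset_polynomial_aeval A (minpoly ℝ A) ⟨x, hx, rfl⟩
  rw [minpoly.aeval] at h
  have h0 : Polynomial.eval x (minpoly ℝ A) = 0 := by
    by_contra hne
    refine h ?_
    rw [spectrum.mem_resolventSet_iff, sub_zero]
    exact (IsUnit.mk0 _ hne).map (algebraMap ℝ (V →L[ℂ] V))
  exact (Polynomial.mem_roots (minpoly.ne_zero hint)).2 h0

theorem cfc_apply_of_apply_eq_smul {A : V →L[ℂ] V} (hA : IsSelfAdjoint A) {x : ℝ} {e : V}
    (h : A e = (x : ℂ) • e) (f : ℝ → ℝ) : cfc f A e = (f x : ℂ) • e := by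
  classical
  set s : Finset ℝ := insert x (finite_real_spectrum A).toFinset with hs
  set q := Lagrange.interpolate s id f with hq
  have hev : ∀ y ∈ s, q.eval y = f y := fun y hy =>
    Lagrange.eval_interpolate_at_node (v := id) f (Function.injective_id.injOn) hy
  rw [cfc_congr (g := q.eval) (fun y hy => (hev y (by simp [hs, hy])).symm), cfc_polynomial q A hA,
    aeval_apply_of_apply_eq_smul h, hev x (by simp [hs])]

theorem inner_cfc_apply {A : V →L[ℂ] V} (hA : IsSelfAdjoint A) {x : ℝ} {e : V}
    (h : A e = (x : ℂ) • e) (f : ℝ → ℝ) (v : V) : ⟪e, cfc f A v⟫ = f x * ⟪e, v⟫ := by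
  have hs : IsSelfAdjoint (cfc f A) := cfc_predicate f A
  rw [← ContinuousLinearMap.adjoint_inner_left, ← ContinuousLinearMap.star_eq_adjoint, hs.star_eq,
    cfc_apply_of_apply_eq_smul hA h, inner_smul_left, Complex.conj_ofReal]

theorem inner_eq_relaxation {α x : ℝ} (h0 : 0 < α) (h1 : α < 1) {A : V →L[ℂ] V}
    (hA : IsSelfAdjoint A) (hx : 0 < x) {e : V} (he : A e = (x : ℂ) • e) {u u' : ℝ → V}
    (hu : ContinuousOn u (Ici 0)) (hd : ∀ t : ℝ, 0 < t → HasDerivAt u (u' t) t)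
    (hi : ∀ t : ℝ, 0 < t → IntegrableOn (fun s => (t - s) ^ (-α) * ‖u' s‖) (Ioo 0 t))
    (heq : ∀ t : ℝ, 0 < t → caputo α u' t + A (u t) = 0) {t : ℝ} (ht : 0 < t) :
    ⟪e, u t⟫ = ⟪e, u 0⟫ * relaxation α x t := by
  have hderiv : ∀ {t : ℝ}, 0 < t → u' t = deriv u t := fun ht => (hd _ ht).deriv.symm
  have : CompleteSpace V := FiniteDimensional.complete ℂ V
  borelize V
  have hmeas : Measurable (deriv u) := measurable_deriv u
  have hint : ∀ t : ℝ, 0 < t →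
      IntegrableOn (fun s => ((t - s) ^ (-α) : ℝ) • deriv u s) (Ioo 0 t) := by
    intro t ht
    refine (hi t ht).mono' ?_ ?_
    · exact ((by fun_prop : Measurable fun s : ℝ => (t - s) ^ (-α)).aestronglyMeasurable).smul
        (stronglyMeasurable_deriv u).aestronglyMeasurable
    · filter_upwards [ae_restrict_mem measurableSet_Ioo] with s hs
      have : 0 < t - s := sub_pos.2 hs.2
      rw [norm_smul, Real.norm_of_nonneg (by positivity), hderiv hs.1]
  refine eq_relaxation_of_caputo (w := fun t => ⟪e, u t⟫) (w' := fun t => ⟪e, deriv u t⟫) h0 h1 hx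
    (continuousOn_const.inner hu) (measurable_const.inner hmeas) ?_ ?_ ?_ ht
  · intro t ht
    rw [← hderiv ht]
    simpa using (hasDerivAt_const t e).inner ℂ (hd t ht)
  · intro t ht
    refine ((hi t ht).mul_const ‖e‖).mono' ?_ ?_
    · exact Measurable.aestronglyMeasurable
        (Measurable.mul (by fun_prop) (measurable_const.inner hmeas).norm)
    · filter_upwards [ae_restrict_mem measurableSet_Ioo] with s hs
      have : 0 < t - s := sub_pos.2 hs.2
      rw [norm_mul, norm_norm, Real.norm_of_nonneg (by positivity), hderiv hs.1, mul_assoc,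
        mul_comm ‖deriv u s‖]
      gcongr
      exact norm_inner_le_norm _ _
  · intro t ht
    have h := congrArg (fun y => ⟪e, y⟫) (heq t ht)
    have hc : ∫ s in Ioo 0 t, ((t - s) ^ (-α) : ℝ) • u' s =
        ∫ s in Ioo 0 t, ((t - s) ^ (-α) : ℝ) • deriv u s :=
      setIntegral_congr_fun measurableSet_Ioo fun s hs => by simp only [hderiv hs.1]
    have hAe : ⟪e, A (u t)⟫ = x * ⟪e, u t⟫ := by
      rw [← ContinuousLinearMap.adjoint_inner_left, ← ContinuousLinearMap.star_eq_adjoint,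
        hA.star_eq, he, inner_smul_left, Complex.conj_ofReal]
    simp only [caputo, inner_add_right, inner_zero_right] at h
    rw [hAe, hc, RCLike.real_smul_eq_coe_smul (K := ℂ), inner_smul_right,
      ← integral_inner (hint t ht)] at h
    simp_rw [RCLike.real_smul_eq_coe_smul (K := ℂ), inner_smul_right] at h
    exact h

end FunctionalCalculus

theorem norm_shiftPow_second_difference_le {α : ℝ} (h0 : 0 < α) (h1 : α < 1)
    {V : Type} [NormedAddCommGroup V] [InnerProductSpace ℂ V] [FiniteDimensional ℂ V]
    {A : V →L[ℂ] V} (hA : IsSelfAdjoint A) (hpos : ∀ x : V, x ≠ 0 → 0 < (⟪A x, x⟫).re)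
    {u u' : ℝ → V} (hu : ContinuousOn u (Ici 0)) (hd : ∀ t : ℝ, 0 < t → HasDerivAt u (u' t) t)
    (hi : ∀ t : ℝ, 0 < t → IntegrableOn (fun s => (t - s) ^ (-α) * ‖u' s‖) (Ioo 0 t))
    (heq : ∀ t : ℝ, 0 < t → caputo α u' t + A (u t) = 0) {β : ℝ} (hβ : 0 ≤ β) (hβ' : β ≤ 1)
    {τ : ℝ} (hτ : 0 < τ) {n : ℕ} (hn : 3 ≤ n) :
    ‖shiftPow A τ α (1 / 2) ((τ ^ 2)⁻¹ • (u ((n : ℝ) * τ) - (2 : ℝ) • u (((n : ℝ) - 1) * τ)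
      + u (((n : ℝ) - 2) * τ)))‖ ≤
      108 * relaxConst α * ((n : ℝ) * τ) ^ (β * α - 2) * ‖opRPow A β (u 0)‖ := by
  have hn' : (3 : ℝ) ≤ n := by exact_mod_cast hn
  have hC := relaxConst_pos h0 h1
  set C := 108 * relaxConst α * ((n : ℝ) * τ) ^ (β * α - 2) with hCdef
  have hC0 : 0 ≤ C := by positivity
  have hsymm : (A : V →ₗ[ℂ] V).IsSymmetric :=
    ContinuousLinearMap.isSelfAdjoint_iff_isSymmetric.1 hA
  set b := hsymm.eigenvectorBasis rfl with hb
  set x := hsymm.eigenvalues rfl with hx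
  have hAb : ∀ i, A (b i) = (x i : ℂ) • b i := fun i => hsymm.apply_eigenvectorBasis rfl i
  have hx0 : ∀ i, 0 < x i := by
    intro i
    have h := hpos (b i) (b.orthonormal.ne_zero i)
    rw [hAb, inner_smul_left, inner_self_eq_norm_sq_to_K, b.orthonormal.1 i] at h
    simpa using h
  rw [← abs_of_nonneg (norm_nonneg (shiftPow A τ α (1 / 2) _)),
    ← abs_of_nonneg (mul_nonneg hC0 (norm_nonneg _)), ← sq_le_sq, mul_pow,
    ← b.sum_sq_norm_inner_right, ← b.sum_sq_norm_inner_right, Finset.mul_sum]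
  refine Finset.sum_le_sum fun i _ => ?_
  rw [← mul_pow]
  refine pow_le_pow_left₀ (norm_nonneg _) ?_ 2
  have hrel : ∀ {t : ℝ}, 0 < t → ⟪b i, u t⟫ = ⟪b i, u 0⟫ * relaxation α (x i) t := fun ht =>
    inner_eq_relaxation h0 h1 hA (hx0 i) (hAb i) hu hd hi heq ht
  have hscalar := weighted_second_difference_relaxation_le h0 h1 (hx0 i) hβ hβ' hτ hn
  have hxi := hx0 i
  have hT : 0 < (n : ℝ) * τ := by positivity
  have hT₁ : 0 < ((n : ℝ) - 1) * τ := mul_pos (by linarith) hτ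
  have hT₂ : 0 < ((n : ℝ) - 2) * τ := mul_pos (by linarith) hτ
  rw [shiftPow, opRPow, inner_cfc_apply hA (hAb i), inner_cfc_apply hA (hAb i),
    RCLike.real_smul_eq_coe_smul (K := ℂ), RCLike.real_smul_eq_coe_smul (K := ℂ), inner_smul_right,
    inner_add_right, inner_sub_right, inner_smul_right, hrel hT, hrel hT₁, hrel hT₂]
  have e : ((τ ^ 2)⁻¹ : ℝ) * (⟪b i, u 0⟫ * relaxation α (x i) (n * τ) -
      ((2 : ℝ) : ℂ) * (⟪b i, u 0⟫ * relaxation α (x i) ((n - 1) * τ)) +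
      ⟪b i, u 0⟫ * relaxation α (x i) ((n - 2) * τ)) =
      ((τ ^ 2)⁻¹ : ℝ) * (((relaxation α (x i) (n * τ) - 2 * relaxation α (x i) ((n - 1) * τ) +
        relaxation α (x i) ((n - 2) * τ) : ℝ) : ℂ) * ⟪b i, u 0⟫) := by
    push_cast; ring
  erw [e]
  rw [norm_mul, norm_mul, norm_mul, norm_mul, norm_real, norm_real, norm_real, norm_real,
    Real.norm_eq_abs (_ + _), Real.norm_of_nonneg (by positivity : 0 ≤ (x i) ^ β),
    Real.norm_of_nonneg (by positivity : 0 ≤ (τ ^ 2)⁻¹),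
    Real.norm_of_nonneg (by positivity), ← mul_assoc, ← mul_assoc, ← mul_assoc]
  refine mul_le_mul_of_nonneg_right ?_ (norm_nonneg _)
  rw [mul_assoc]
  exact hscalar

end Subdiffusion

/-- Weighted bound on the second backward difference of the solution of the
homogeneous subdiffusion problem:
`‖(I + τ^α A)^{1/2} ∂̄_τ² u(t_n)‖ ≤ c t_n^{βα-2} ‖A^β v‖`. -/
theorem weighted_second_difference_bound (α : ℝ) (hα0 : 0 < α) (hα1 : α < 1) :
    ∃ c : ℝ, 0 < c ∧
      ∀ (V : Type) (_ : NormedAddCommGroup V) (_ : InnerProductSpace ℂ V)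
        (_ : FiniteDimensional ℂ V) (_ : Nontrivial V)
        (A : V →L[ℂ] V), IsSelfAdjoint A →
        (∀ x : V, x ≠ 0 → 0 < (⟪A x, x⟫).re) →
        ∀ (v : V) (u u' : ℝ → V),
        ContinuousOn u (Set.Ici 0) → u 0 = v →
        (∀ t : ℝ, 0 < t → HasDerivAt u (u' t) t) →
        (∀ t : ℝ, 0 < t →
          MeasureTheory.IntegrableOn (fun s => (t - s) ^ (-α) * ‖u' s‖) (Set.Ioo 0 t)) →
        (∀ t : ℝ, 0 < t → caputo α u' t + A (u t) = 0) →
        ∀ β : ℝ, 0 ≤ β → β ≤ 1 → ∀ τ : ℝ, 0 < τ → ∀ n : ℕ, 3 ≤ n →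
          ‖shiftPow A τ α (1 / 2)
              ((τ ^ 2)⁻¹ • (u ((n : ℝ) * τ) - (2 : ℝ) • u (((n : ℝ) - 1) * τ)
                + u (((n : ℝ) - 2) * τ)))‖
            ≤ c * ((n : ℝ) * τ) ^ (β * α - 2) * ‖opRPow A β v‖ := by
  refine ⟨108 * Subdiffusion.relaxConst α, mul_pos (by norm_num)
    (Subdiffusion.relaxConst_pos hα0 hα1), ?_⟩
  intro V _ _ _ _ A hA hpos v u u' hu hv hd hi heq β hβ hβ' τ hτ n hn
  subst hv
  exact Subdiffusion.norm_shiftPow_second_difference_le hα0 hα1 hA hpos hu hd hi heq hβ hβ' hτ hn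
end
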